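/- arXiv:1112.1296 — 3 statements merged into one kernel-verified Lean document; each statement's English description precedes it below -/
import Mathlib

section
/- Let m be a natural number and let f : ℝ^m → ℝ be a continuous function on m-dimensional Euclidean space. Then f is WUA_d (densely weakly uniformly approachable) if and only if f has distant connected components of fibers (DCF). -/
/-- A continuous `f : X → ℝ` is densely weakly uniformly approachable (WUA_d) if for
every point `x ∈ X` and every dense set `M ⊆ X` there is a uniformly continuous
`g : X → ℝ` with `g x = f x` and `g(M) ⊆ f(M)`. -/
def IsWUAd {X : Type*} [MetricSpace X] (f : X → ℝ) : Prop :=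
  ∀ x : X, ∀ M : Set X, Dense M →
    ∃ g : X → ℝ, UniformContinuous g ∧ g x = f x ∧ g '' M ⊆ f '' M

/-- A function `f : X → ℝ` has distant connected components of fibers (DCF) if any two
nonempty connected subsets of distinct fibers are at positive distance. -/
def HasDCF {X : Type*} [MetricSpace X] (f : X → ℝ) : Prop :=
  ∀ u v : ℝ, u ≠ v → ∀ A B : Set X, A.Nonempty → B.Nonempty →
    IsPreconnected A → IsPreconnected B → A ⊆ f ⁻¹' {u} → B ⊆ f ⁻¹' {v} →
    ∃ ε > (0 : ℝ), ∀ a ∈ A, ∀ b ∈ B, ε ≤ dist a b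


open Set Filter Topology

section Separation

variable {X : Type*} [TopologicalSpace X]

/-- The set `Z` avoids `p` and `q` and meets every connected set containing both. -/
def Separates (Z : Set X) (p q : X) : Prop :=
  p ∉ Z ∧ q ∉ Z ∧ ∀ P : Set X, IsPreconnected P → p ∈ P → q ∈ P → (P ∩ Z).Nonempty

theorem Separates.mono {Z Z' : Set X} {p q : X} (h : Separates Z p q) (hZ : Z ⊆ Z')
    (hp : p ∉ Z') (hq : q ∉ Z') : Separates Z' p q :=
  ⟨hp, hq, fun P hP hpP hqP => (h.2.2 P hP hpP hqP).mono (inter_subset_inter_right _ hZ)⟩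

theorem frontier_connectedComponentIn_subset [LocallyConnectedSpace X] {F : Set X}
    (hF : IsOpen F) (p : X) : frontier (connectedComponentIn F p) ⊆ Fᶜ := by
  intro z hz hzF
  have ho : IsOpen (connectedComponentIn F z) := hF.connectedComponentIn
  have hzz : z ∈ connectedComponentIn F z := mem_connectedComponentIn hzF
  obtain ⟨y, hy, hyp⟩ := mem_closure_iff.1 hz.1 _ ho hzz
  have e : connectedComponentIn F p = connectedComponentIn F z :=
    (connectedComponentIn_eq hyp).trans (connectedComponentIn_eq hy).symm
  rw [← e] at hzz ho
  exact hz.2 (by rwa [ho.interior_eq])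

theorem IsPreconnected.inter_frontier_nonempty' {P V : Set X} (hP : IsPreconnected P)
    (h1 : (P ∩ V).Nonempty) (h2 : (P ∩ Vᶜ).Nonempty) : (P ∩ frontier V).Nonempty := by
  by_contra h
  have h' : ∀ z ∈ P, z ∉ frontier V := fun z hz hz' => h ⟨z, hz, hz'⟩
  obtain ⟨z, hz, hz1, hz2⟩ := hP (interior V) (closure V)ᶜ isOpen_interior
    isClosed_closure.isOpen_compl
    (fun z hz => by
      by_cases hc : z ∈ closure V
      · exact Or.inl (by_contra fun hi => h' z hz ⟨hc, hi⟩)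
      · exact Or.inr hc)
    (by
      obtain ⟨z, hz, hzV⟩ := h1
      exact ⟨z, hz, by_contra fun hi => h' z hz ⟨subset_closure hzV, hi⟩⟩)
    (by
      obtain ⟨z, hz, hzV⟩ := h2
      exact ⟨z, hz, fun hc => h' z hz ⟨hc, fun hi => hzV (interior_subset hi)⟩⟩)
  exact hz2 (interior_subset_closure hz1)

theorem isClosed_connectedComponentIn {F : Set X} (hF : IsClosed F) (p : X) :
    IsClosed (connectedComponentIn F p) := by
  by_cases hp : p ∈ F
  · refine isClosed_of_closure_subset
      (isPreconnected_connectedComponentIn.closure.subset_connectedComponentIn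
        (subset_closure (mem_connectedComponentIn hp)) ?_)
    exact closure_minimal (connectedComponentIn_subset F p) hF
  · simp [connectedComponentIn_eq_empty hp]

/-- In a simply connected space, if a union of two disjoint closed sets separates two points,
then one of the two sets separates them. -/
theorem Separates.of_union {X : Type*} [MetricSpace X] [SimplyConnectedSpace X]
    [LocallyPathConnectedSpace X] {Z₁ Z₂ : Set X} {p q : X} (h₁ : IsClosed Z₁) (h₂ : IsClosed Z₂)
    (hd : Disjoint Z₁ Z₂) (h : Separates (Z₁ ∪ Z₂) p q) :
    Separates Z₁ p q ∨ Separates Z₂ p q := by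
  rcases Z₁.eq_empty_or_nonempty with rfl | hne₁
  · right; simpa using h
  rcases Z₂.eq_empty_or_nonempty with rfl | hne₂
  · left; simpa using h
  obtain ⟨hp, hq, hsep⟩ := h
  simp only [mem_union, not_or] at hp hq
  by_contra hcon
  simp only [Separates, hp.1, hp.2, hq.1, hq.2, not_false_eq_true, true_and, not_or,
    not_forall] at hcon
  obtain ⟨⟨P₁, hP₁, hpP₁, hqP₁, hd₁⟩, ⟨P₂, hP₂, hpP₂, hqP₂, hd₂⟩⟩ := hcon
  rw [not_nonempty_iff_eq_empty] at hd₁ hd₂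
  have pi := Real.pi_pos
  have i₁ : ∀ y, 0 ≤ Metric.infDist y Z₁ := fun y => Metric.infDist_nonneg
  have i₂ : ∀ y, 0 ≤ Metric.infDist y Z₂ := fun y => Metric.infDist_nonneg
  have z₁ : ∀ y, Metric.infDist y Z₁ = 0 ↔ y ∈ Z₁ := fun y =>
    (h₁.mem_iff_infDist_zero hne₁).symm
  have z₂ : ∀ y, Metric.infDist y Z₂ = 0 ↔ y ∈ Z₂ := fun y =>
    (h₂.mem_iff_infDist_zero hne₂).symm
  have hs : ∀ y, 0 < Metric.infDist y Z₁ + Metric.infDist y Z₂ := by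
    intro y
    rcases (add_nonneg (i₁ y) (i₂ y)).lt_or_eq with h | h
    · exact h
    · have a : Metric.infDist y Z₁ = 0 := by linarith [i₁ y, i₂ y]
      have b : Metric.infDist y Z₂ = 0 := by linarith [i₁ y, i₂ y]
      exact (disjoint_left.1 hd ((z₁ y).1 a) ((z₂ y).1 b)).elim
  set H : X → ℝ := fun y =>
    Real.pi * (Metric.infDist y Z₁ / (Metric.infDist y Z₁ + Metric.infDist y Z₂)) with hH
  have Hc : Continuous H := by
    refine continuous_const.mul ((Metric.continuous_infDist_pt _).div
      ((Metric.continuous_infDist_pt _).add (Metric.continuous_infDist_pt _)) fun y => (hs y).ne')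
  have H0 : ∀ y ∈ Z₁, H y = 0 := fun y hy => by simp [hH, (z₁ y).2 hy]
  have H1 : ∀ y ∈ Z₂, H y = Real.pi := fun y hy => by
    have := hs y
    simp only [hH, (z₂ y).2 hy, add_zero] at this ⊢
    rw [div_self this.ne', mul_one]
  have Hpos : ∀ y ∉ Z₁, 0 < H y := fun y hy =>
    mul_pos pi (div_pos (lt_of_le_of_ne (i₁ y) fun h => hy ((z₁ y).1 h.symm)) (hs y))
  have Hlt : ∀ y ∉ Z₂, H y < Real.pi := fun y hy => by
    have : Metric.infDist y Z₁ / (Metric.infDist y Z₁ + Metric.infDist y Z₂) < 1 := by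
      rw [div_lt_one (hs y)]
      linarith [lt_of_le_of_ne (i₂ y) fun h => hy ((z₂ y).1 h.symm)]
    exact mul_lt_of_lt_one_right pi this
  have H0' : ∀ y, 0 ≤ H y := fun y => by
    by_cases hy : y ∈ Z₁
    · exact (H0 y hy).ge
    · exact (Hpos y hy).le
  have H1' : ∀ y, H y ≤ Real.pi := fun y => by
    by_cases hy : y ∈ Z₂
    · exact (H1 y hy).le
    · exact (Hlt y hy).le
  set F : Set X := (Z₁ ∪ Z₂)ᶜ with hF
  have hFo : IsOpen F := (h₁.union h₂).isOpen_compl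
  set U := connectedComponentIn F p with hU
  have hpU : p ∈ U := mem_connectedComponentIn (by simp [hF, hp])
  have hqU : q ∉ U := fun hqU => by
    obtain ⟨z, hz, hz'⟩ := hsep U isPreconnected_connectedComponentIn hpU hqU
    exact connectedComponentIn_subset F p hz hz'
  classical
  let φ : X → Circle := U.piecewise (fun y => Circle.exp (H y)) (fun y => Circle.exp (-H y))
  have hφ : Continuous φ := by
    refine continuous_piecewise ?_ (by fun_prop) (by fun_prop)
    intro z hz
    have hz' := frontier_connectedComponentIn_subset hFo p hz
    rw [hF, compl_compl] at hz'
    rcases hz' with hz' | hz'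
    · simp [H0 z hz']
    · simp only [H1 z hz']
      exact Circle.exp_eq_exp.2 ⟨1, by push_cast; ring⟩
  have hφ' : ∀ y, φ y = Circle.exp (H y) ∨ φ y = Circle.exp (-H y) := fun y => by
    by_cases hy : y ∈ U <;> simp [φ, hy]
  obtain ⟨θ, ⟨hθp, hθ⟩, -⟩ := Circle.isCoveringMap_exp.existsUnique_continuousMap_lifts
    ⟨φ, hφ⟩ p (H p) (by simp [φ, hpU])
  have hθ' : ∀ y, Circle.exp (θ y) = φ y := fun y => congr_fun hθ y
  have key : ∀ y, ∃ k : ℤ, θ y = H y + k * (2 * Real.pi) ∨ θ y = -H y + k * (2 * Real.pi) := by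
    intro y
    rcases hφ' y with h | h <;> rw [← hθ' y, Circle.exp_eq_exp] at h <;> obtain ⟨k, hk⟩ := h
    · exact ⟨k, Or.inl hk⟩
    · exact ⟨k, Or.inr hk⟩
  have nomult : ∀ n : ℤ, 0 < n * (2 * Real.pi) → n * (2 * Real.pi) < 2 * Real.pi → False := by
    intro n h0 h1
    have c1 : (0 : ℝ) < n := by
      by_contra! hle
      nlinarith
    have c2 : (n : ℝ) < 1 := by
      by_contra! hle
      nlinarith
    have c1' : 0 < n := by exact_mod_cast c1
    have c2' : n < 1 := by exact_mod_cast c2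
    omega
  have avoid₁ : ∀ y ∉ Z₁, ∀ k : ℤ, θ y ≠ k * (2 * Real.pi) := by
    intro y hy k hk
    have h0 := Hpos y hy
    have h1 := H1' y
    obtain ⟨n, hn | hn⟩ := key y
    · exact nomult (k - n) (by push_cast; linarith) (by push_cast; linarith)
    · exact nomult (n - k) (by push_cast; linarith) (by push_cast; linarith)
  have avoid₂ : ∀ y ∉ Z₂, ∀ k : ℤ, θ y ≠ Real.pi + k * (2 * Real.pi) := by
    intro y hy k hk
    have h0 := H0' y
    have h1 := Hlt y hy
    obtain ⟨n, hn | hn⟩ := key y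
    · exact nomult (n - k) (by push_cast; linarith) (by push_cast; linarith)
    · exact nomult (n - k) (by push_cast; linarith) (by push_cast; linarith)
  have I₁ := (hP₁.image θ θ.continuous.continuousOn).ordConnected
  have I₂ := (hP₂.image θ θ.continuous.continuousOn).ordConnected
  have nZ₁ : ∀ y ∈ P₁, y ∉ Z₁ := fun y hy hy' => by
    have : y ∈ P₁ ∩ Z₁ := ⟨hy, hy'⟩
    simp [hd₁] at this
  have nZ₂ : ∀ y ∈ P₂, y ∉ Z₂ := fun y hy hy' => by
    have : y ∈ P₂ ∩ Z₂ := ⟨hy, hy'⟩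
    simp [hd₂] at this
  have a1 := Hpos p hp.1
  have a2 := Hlt p hp.2
  have a3 := Hpos q hq.1
  have a4 := Hlt q hq.2
  have b1 : 0 < θ q := by
    by_contra! hle
    obtain ⟨y, hy, hy'⟩ := I₁.out ⟨q, hqP₁, rfl⟩ ⟨p, hpP₁, rfl⟩
      (show (0 : ℝ) ∈ Icc (θ q) (θ p) from ⟨hle, by rw [hθp]; exact a1.le⟩)
    exact avoid₁ y (nZ₁ y hy) 0 (by simpa using hy')
  have b2 : θ q < Real.pi := by
    by_contra! hle
    obtain ⟨y, hy, hy'⟩ := I₂.out ⟨p, hpP₂, rfl⟩ ⟨q, hqP₂, rfl⟩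
      (show Real.pi ∈ Icc (θ p) (θ q) from ⟨by rw [hθp]; exact a2.le, hle⟩)
    exact avoid₂ y (nZ₂ y hy) 0 (by simpa using hy')
  have hq' := hθ' q
  simp only [φ, hqU, not_false_eq_true, piecewise_eq_of_notMem, Circle.exp_eq_exp] at hq'
  obtain ⟨k, hk⟩ := hq'
  exact nomult k (by linarith) (by linarith)

end Separation

section Minimal

theorem not_separates_iff {X : Type*} [TopologicalSpace X] {Z : Set X} {p q : X}
    (hp : p ∉ Z) (hq : q ∉ Z) :
    ¬ Separates Z p q ↔ ∃ P : Set X, IsPreconnected P ∧ p ∈ P ∧ q ∈ P ∧ Disjoint P Z := by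
  simp only [Separates, hp, hq, not_false_eq_true, true_and, not_forall,
    not_nonempty_iff_eq_empty, disjoint_iff_inter_eq_empty, exists_prop]

theorem exists_isCompact_of_not_separates {X : Type*} [TopologicalSpace X]
    [LocallyPathConnectedSpace X] {Z : Set X} {p q : X} (hZ : IsClosed Z) (hp : p ∉ Z)
    (hq : q ∉ Z) (h : ¬ Separates Z p q) :
    ∃ P : Set X, IsCompact P ∧ IsPreconnected P ∧ p ∈ P ∧ q ∈ P ∧ Disjoint P Z := by
  obtain ⟨P, hP, hpP, hqP, hd⟩ := (not_separates_iff hp hq).1 h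
  set G := connectedComponentIn Zᶜ p with hG
  have hGo : IsOpen G := hZ.isOpen_compl.connectedComponentIn
  have hPG : P ⊆ G := hP.subset_connectedComponentIn hpP hd.subset_compl_right
  have hGc : IsConnected G := ⟨⟨p, hPG hpP⟩, isPreconnected_connectedComponentIn⟩
  obtain ⟨γ, hγ⟩ := (hGo.isConnected_iff_isPathConnected.1 hGc).joinedIn p (hPG hpP) q (hPG hqP)
  refine ⟨range γ, isCompact_range γ.continuous, isPreconnected_range γ.continuous,
    ⟨0, γ.source⟩, ⟨1, γ.target⟩, ?_⟩
  rw [← subset_compl_iff_disjoint_right]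
  rintro _ ⟨t, rfl⟩
  exact connectedComponentIn_subset _ _ (hγ t)

/-- A closed set separating two points of a simply connected space contains a connected closed
set separating them. -/
theorem Separates.exists_isPreconnected {X : Type*} [MetricSpace X] [SimplyConnectedSpace X]
    [LocallyPathConnectedSpace X] {Z : Set X} {p q : X} (hZ : IsClosed Z)
    (h : Separates Z p q) :
    ∃ C ⊆ Z, IsClosed C ∧ IsPreconnected C ∧ Separates C p q := by
  obtain ⟨C, hCZ, hC⟩ := zorn_superset_nonempty {C : Set X | IsClosed C ∧ Separates C p q} (by
    intro c hc hchain hne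
    refine ⟨⋂₀ c, ⟨isClosed_sInter fun s hs => (hc hs).1, ?_⟩, fun s hs => sInter_subset_of_mem hs⟩
    obtain ⟨s₀, hs₀⟩ := hne
    have hp : p ∉ ⋂₀ c := fun h => (hc hs₀).2.1 (h s₀ hs₀)
    have hq : q ∉ ⋂₀ c := fun h => (hc hs₀).2.2.1 (h s₀ hs₀)
    by_contra hcon
    obtain ⟨P, hPc, hP, hpP, hqP, hd⟩ := exists_isCompact_of_not_separates
      (isClosed_sInter fun s hs => (hc hs).1) hp hq hcon
    have : (⋂₀ ((fun s => P ∩ s) '' c)).Nonempty := by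
      have hdir : DirectedOn (fun x1 x2 => x1 ⊇ x2) ((fun s => P ∩ s) '' c) := by
        rintro _ ⟨s, hs, rfl⟩ _ ⟨t, ht, rfl⟩
        rcases hchain.total hs ht with h | h
        · exact ⟨_, ⟨s, hs, rfl⟩, subset_rfl, inter_subset_inter_right _ h⟩
        · exact ⟨_, ⟨t, ht, rfl⟩, inter_subset_inter_right _ h, subset_rfl⟩
      have : Nonempty ((fun s => P ∩ s) '' c) := ⟨⟨_, ⟨s₀, hs₀, rfl⟩⟩⟩
      refine IsCompact.nonempty_sInter_of_directed_nonempty_isCompact_isClosed hdir ?_ ?_ ?_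
      · rintro _ ⟨s, hs, rfl⟩
        exact (hc hs).2.2.2 P hP hpP hqP
      · rintro _ ⟨s, hs, rfl⟩
        exact hPc.inter_right (hc hs).1
      · rintro _ ⟨s, hs, rfl⟩
        exact hPc.isClosed.inter (hc hs).1
    obtain ⟨z, hz⟩ := this
    simp only [sInter_image, mem_iInter] at hz
    exact disjoint_left.1 hd (hz s₀ hs₀).1 (mem_sInter.2 fun s hs => (hz s hs).2)) Z ⟨hZ, h⟩
  refine ⟨C, hCZ, hC.prop.1, ?_, hC.prop.2⟩
  rw [isPreconnected_iff_subset_of_disjoint_closed]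
  intro u v hu hv huv hd
  have e : C = (C ∩ u) ∪ (C ∩ v) := by
    rw [← inter_union_distrib_left, inter_eq_left.2 huv]
  have hsep := hC.prop.2
  rw [e] at hsep
  rcases hsep.of_union (hC.prop.1.inter hu) (hC.prop.1.inter hv)
    (by
      rw [disjoint_left]
      intro z hz hz'
      have : z ∈ C ∩ (u ∩ v) := ⟨hz.1, hz.2, hz'.2⟩
      simp [hd] at this) with h | h
  · exact Or.inl fun z hz => (hC.le_of_le ⟨hC.prop.1.inter hu, h⟩ inter_subset_left hz).2
  · exact Or.inr fun z hz => (hC.le_of_le ⟨hC.prop.1.inter hv, h⟩ inter_subset_left hz).2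

end Minimal

section Forward

theorem separates_level {X : Type*} [TopologicalSpace X] {f : X → ℝ} (hf : Continuous f)
    {p q : X} {c : ℝ} (hp : f p < c) (hq : c < f q) : Separates (f ⁻¹' {c}) p q := by
  refine ⟨hp.ne, hq.ne', fun P hP hpP hqP => ?_⟩
  obtain ⟨z, hz, hz'⟩ := hP.intermediate_value hpP hqP hf.continuousOn ⟨hp.le, hq.le⟩
  exact ⟨z, hz, hz'⟩

theorem exists_level_separator {X : Type*} [MetricSpace X] [SimplyConnectedSpace X]
    [LocallyPathConnectedSpace X] {f : X → ℝ} (hf : Continuous f)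
    {p q : X} {c : ℝ} (hp : f p < c) (hq : c < f q) :
    ∃ C ⊆ f ⁻¹' {c}, IsClosed C ∧ IsPreconnected C ∧ Separates C p q :=
  (separates_level hf hp hq).exists_isPreconnected (isClosed_singleton.preimage hf)

theorem IsPreconnected.image_subsingleton_of_countable {X : Type*} [TopologicalSpace X]
    {g : X → ℝ} (hg : Continuous g) {A : Set X} (hA : IsPreconnected A)
    (hc : (g '' A).Countable) {a b : X} (ha : a ∈ A) (hb : b ∈ A) : g a = g b :=
  hc.isTotallyDisconnected _ subset_rfl (hA.image g hg.continuousOn)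
    (mem_image_of_mem g ha) (mem_image_of_mem g hb)

theorem countable_setOf_interior_preimage_nonempty {X : Type*} [TopologicalSpace X]
    [TopologicalSpace.SeparableSpace X] (f : X → ℝ) :
    {c : ℝ | (interior (f ⁻¹' {c})).Nonempty}.Countable := by
  refine Set.PairwiseDisjoint.countable_of_nonempty_interior (s := fun c => f ⁻¹' {c}) ?_
    fun c hc => hc
  intro c _ d _ hcd
  exact Disjoint.preimage f (disjoint_singleton.2 hcd)

variable {X : Type*} [NormedAddCommGroup X] [NormedSpace ℝ X]
  [TopologicalSpace.SeparableSpace X]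

theorem IsWUAd.exists_pos_le_dist {f : X → ℝ} (hf : Continuous f) (h : IsWUAd f) {u v : ℝ}
    (huv : u < v) {A B : Set X} (hAne : A.Nonempty) (hBne : B.Nonempty) (hA : IsPreconnected A)
    (hB : IsPreconnected B) (hAu : A ⊆ f ⁻¹' {u}) (hBv : B ⊆ f ⁻¹' {v}) :
    ∃ ε > (0 : ℝ), ∀ a ∈ A, ∀ b ∈ B, ε ≤ dist a b := by
  by_contra! hcon
  obtain ⟨a₀, ha₀⟩ := hAne
  obtain ⟨b₀, hb₀⟩ := hBne
  have hsep : ∀ w ∈ Ioo u v, ∃ C ⊆ f ⁻¹' {w}, IsPreconnected C ∧ Separates C a₀ b₀ := by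
    intro w hw
    have h1 : f a₀ < w := by rw [show f a₀ = u from hAu ha₀]; exact hw.1
    have h2 : w < f b₀ := by rw [show f b₀ = v from hBv hb₀]; exact hw.2
    obtain ⟨C, hC, -, hC', hC''⟩ := exists_level_separator hf h1 h2
    exact ⟨C, hC, hC', hC''⟩
  choose! F hFw hFc hFs using hsep
  have hseg : ∀ w ∈ Ioo u v, ∀ a ∈ A, ∀ b ∈ B, (segment ℝ a b ∩ F w).Nonempty := by
    intro w hw a ha b hb
    have hP : IsPreconnected ((A ∪ segment ℝ a b) ∪ B) :=
      (hA.union a ha (left_mem_segment ℝ a b) (convex_segment a b).isPreconnected).union b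
        (Or.inr (right_mem_segment ℝ a b)) hb hB
    obtain ⟨z, (hz | hz) | hz, hzF⟩ :=
      (hFs w hw).2.2 _ hP (Or.inl (Or.inl ha₀)) (Or.inr hb₀)
    · have e1 : f z = u := hAu hz
      have e2 : f z = w := hFw w hw hzF
      exact absurd hw.1 (by rw [← e1, ← e2]; exact lt_irrefl _)
    · exact ⟨z, hz, hzF⟩
    · have e1 : f z = v := hBv hz
      have e2 : f z = w := hFw w hw hzF
      exact absurd hw.2 (by rw [← e1, ← e2]; exact lt_irrefl _)
  choose! s hs hsF using fun w (hw : w ∈ Ioo u v) => hseg w hw a₀ ha₀ b₀ hb₀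
  have hfs : ∀ w ∈ Ioo u v, f (s w) = w := fun w hw => hFw w hw (hsF w hw)
  set Ω : Set ℝ := Ioo u v \ {c : ℝ | (interior (f ⁻¹' {c})).Nonempty} with hΩ
  have hΩu : ¬ Ω.Countable := fun hc => by
    have : (Ioo u v).Countable :=
      (hc.union (countable_setOf_interior_preimage_nonempty f)).mono fun w hw => by
        by_cases h' : w ∈ {c : ℝ | (interior (f ⁻¹' {c})).Nonempty}
        · exact Or.inr h'
        · exact Or.inl ⟨hw, h'⟩
    exact huv.not_ge (Cardinal.Real.Ioo_countable_iff.1 this)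
  obtain ⟨D, hDs, hDc, hDd⟩ :=
    (TopologicalSpace.IsSeparable.of_separableSpace (s '' Ω)).exists_countable_dense_subset
  obtain ⟨w₀, hw₀, hw₀D⟩ : ∃ w ∈ Ω, s w ∉ D := by
    by_contra! hall
    exact hΩu ((hDc.image f).mono fun w hw => (mem_image _ _ _).2 ⟨s w, hall w hw, hfs w hw.1⟩)
  have hfD : ∀ d ∈ D, f d ∈ Ω ∧ s (f d) = d := by
    intro d hd
    obtain ⟨w, hw, rfl⟩ := hDs hd
    rw [hfs w hw.1]
    exact ⟨hw, rfl⟩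
  have hdense : Dense (f ⁻¹' {w₀})ᶜ := by
    rw [← interior_eq_empty_iff_dense_compl]
    exact not_nonempty_iff_eq_empty.1 hw₀.2
  obtain ⟨D', hD's, hD'c, hD'd⟩ := hdense.exists_countable_dense_subset
  set M : Set X := A ∪ (⋃ d ∈ D, F (f d)) ∪ D' with hM
  have hfM : f '' M ⊆ {u} ∪ f '' D ∪ f '' D' := by
    rintro _ ⟨z, (hz | hz) | hz, rfl⟩
    · exact Or.inl (Or.inl (hAu hz))
    · obtain ⟨d, hd, hz⟩ := mem_iUnion₂.1 hz
      exact Or.inl (Or.inr ⟨d, hd, (hFw _ (hfD d hd).1.1 hz).symm⟩)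
    · exact Or.inr ⟨z, hz, rfl⟩
  have hfMc : (f '' M).Countable :=
    (((countable_singleton u).union (hDc.image f)).union (hD'c.image f)).mono hfM
  have hw₀M : w₀ ∉ f '' M := fun hw => by
    rcases hfM hw with (hw | ⟨d, hd, hw⟩) | ⟨d, hd, hw⟩
    · exact hw₀.1.1.ne' hw
    · refine hw₀D ?_
      rw [← hw, (hfD d hd).2]
      exact hd
    · exact hD's hd hw
  obtain ⟨g, hg, hgx, hgM⟩ := h (s w₀) M (hD'd.mono subset_union_right)
  have hconst : ∀ P ⊆ M, IsPreconnected P → ∀ a ∈ P, ∀ b ∈ P, g a = g b :=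
    fun P hPM hP a ha b hb => hP.image_subsingleton_of_countable hg.continuous
      (hfMc.mono ((image_mono hPM).trans hgM)) ha hb
  have hAM : A ⊆ M := fun z hz => Or.inl (Or.inl hz)
  have hgD : ∀ d ∈ D, g d = g a₀ := by
    intro d hd
    have hFM : F (f d) ⊆ M := fun z hz => Or.inl (Or.inr (mem_iUnion₂.2 ⟨d, hd, hz⟩))
    have hdF : d ∈ F (f d) := by
      have := hsF _ (hfD d hd).1.1
      rwa [(hfD d hd).2] at this
    refine eq_of_forall_dist_le fun η hη => ?_
    obtain ⟨δ, hδ, hgδ⟩ := Metric.uniformContinuous_iff.1 hg η hη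
    obtain ⟨a, ha, b, hb, hab⟩ := hcon δ hδ
    obtain ⟨z, hz, hzF⟩ := hseg _ (hfD d hd).1.1 a ha b hb
    have hza : dist z a < δ := by
      have := dist_add_dist_of_mem_segment hz
      rw [dist_comm z a]
      linarith [dist_nonneg (x := z) (y := b)]
    rw [hconst _ hFM (hFc _ (hfD d hd).1.1) d hdF z hzF, hconst A hAM hA a₀ ha₀ a ha]
    exact (hgδ hza).le
  have hgs : g (s w₀) = g a₀ := by
    have hcl : closure D ⊆ {z | g z = g a₀} :=
      closure_minimal hgD (isClosed_eq hg.continuous continuous_const)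
    exact hcl (hDd ⟨w₀, hw₀, rfl⟩)
  refine hw₀M ?_
  rw [← hfs w₀ hw₀.1, ← hgx, hgs]
  exact hgM ⟨a₀, hAM ha₀, rfl⟩

theorem IsWUAd.hasDCF {f : X → ℝ} (hf : Continuous f) (h : IsWUAd f) : HasDCF f := by
  intro u v huv A B hAne hBne hA hB hAu hBv
  rcases huv.lt_or_gt with huv | huv
  · exact h.exists_pos_le_dist hf huv hAne hBne hA hB hAu hBv
  · obtain ⟨ε, hε, hd⟩ := h.exists_pos_le_dist hf huv hBne hAne hB hA hBv hAu
    exact ⟨ε, hε, fun a ha b hb => by rw [dist_comm]; exact hd b hb a ha⟩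

end Forward

section Hull

variable {X : Type*} [TopologicalSpace X]

/-- The connected component of `x` in the complement of `W`, together with `W`. -/
def hull (x : X) (W : Set X) : Set X := W ∪ connectedComponentIn Wᶜ x

variable {x : X} {W : Set X}

theorem mem_hull_self (hx : x ∉ W) : x ∈ hull x W := Or.inr (mem_connectedComponentIn hx)

theorem subset_hull_of_disjoint {P : Set X} (hP : IsPreconnected P) (hx : x ∈ P)
    (hd : Disjoint P W) : P ⊆ hull x W :=
  (hP.subset_connectedComponentIn hx hd.subset_compl_right).trans subset_union_right

theorem disjoint_hull {C : Set X} (hC : IsPreconnected C) (hd : Disjoint C W) {v : X}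
    (hv : v ∈ C) (hvW : v ∉ hull x W) : Disjoint (hull x W) C := by
  rw [disjoint_left]
  rintro z (hz | hz) hzC
  · exact disjoint_left.1 hd hzC hz
  · refine hvW (Or.inr ?_)
    rw [connectedComponentIn_eq hz]
    exact hC.subset_connectedComponentIn hzC hd.subset_compl_right hv

variable [LocallyConnectedSpace X]

theorem isClosed_hull (hW : IsClosed W) : IsClosed (hull x W) := by
  refine isClosed_of_closure_subset ?_
  rw [hull, closure_union, hW.closure_eq]
  refine union_subset subset_union_left fun z hz => ?_
  by_cases hz' : z ∈ connectedComponentIn Wᶜ x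
  · exact Or.inr hz'
  · have : z ∈ frontier (connectedComponentIn Wᶜ x) :=
      ⟨hz, fun hi => hz' (interior_subset hi)⟩
    exact Or.inl (by simpa using frontier_connectedComponentIn_subset hW.isOpen_compl x this)

variable [PreconnectedSpace X]

theorem isPreconnected_hull (hW : IsClosed W) (hWc : IsPreconnected W) (hne : W.Nonempty)
    (hx : x ∉ W) : IsPreconnected (hull x W) := by
  obtain ⟨w, hw⟩ := hne
  obtain ⟨z, hz⟩ : (frontier (connectedComponentIn Wᶜ x)).Nonempty := by
    refine nonempty_frontier_iff.2 ⟨⟨x, mem_connectedComponentIn hx⟩, fun h => ?_⟩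
    exact connectedComponentIn_subset Wᶜ x (h ▸ mem_univ w) hw
  have hzW : z ∈ W := by
    simpa using frontier_connectedComponentIn_subset hW.isOpen_compl x hz
  have e : hull x W = W ∪ insert z (connectedComponentIn Wᶜ x) := by
    rw [hull, union_insert, insert_eq_of_mem (show z ∈ W ∪ connectedComponentIn Wᶜ x from Or.inl hzW)]
  rw [e]
  exact hWc.union z hzW (mem_insert _ _)
    (isPreconnected_connectedComponentIn.subset_closure (subset_insert _ _)
      (insert_subset hz.1 subset_closure))

theorem hull_subset_hull_or {W' : Set X} (hW : IsClosed W) (hWc : IsPreconnected W)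
    (hne : W.Nonempty) (hx : x ∉ W) (hW' : IsClosed W') (hWc' : IsPreconnected W')
    (hne' : W'.Nonempty) (hx' : x ∉ W') (hd : Disjoint W W') {v : X} (hv : v ∉ hull x W)
    (hv' : v ∉ hull x W') : hull x W ⊆ hull x W' ∨ hull x W' ⊆ hull x W := by
  by_cases h : W' ⊆ hull x W
  swap
  · obtain ⟨t, ht, ht'⟩ := not_subset.1 h
    exact Or.inl (subset_hull_of_disjoint (isPreconnected_hull hW hWc hne hx)
      (mem_hull_self hx) (disjoint_hull hWc' hd.symm ht ht'))
  by_cases h' : W ⊆ hull x W'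
  swap
  · obtain ⟨t, ht, ht'⟩ := not_subset.1 h'
    exact Or.inr (subset_hull_of_disjoint (isPreconnected_hull hW' hWc' hne' hx')
      (mem_hull_self hx') (disjoint_hull hWc hd ht ht'))
  exfalso
  have hvW : v ∉ W := fun h => hv (Or.inl h)
  obtain ⟨w, hw⟩ := hne
  have hd' : Disjoint (hull v W) W' := by
    rw [disjoint_left]
    rintro t (ht | ht) htW'
    · exact disjoint_left.1 hd ht htW'
    · rcases h htW' with h1 | h1
      · exact disjoint_left.1 hd h1 htW'
      · refine hv (Or.inr ?_)
        rw [connectedComponentIn_eq h1, ← connectedComponentIn_eq ht]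
        exact mem_connectedComponentIn hvW
  have hw' : w ∈ connectedComponentIn W'ᶜ x :=
    (h' hw).resolve_left fun h => disjoint_left.1 hd hw h
  refine hv' (Or.inr ?_)
  rw [connectedComponentIn_eq hw']
  exact (isPreconnected_hull hW hWc ⟨w, hw⟩ hvW).subset_connectedComponentIn (Or.inl hw)
    hd'.subset_compl_right (mem_hull_self hvW)

end Hull

section FiberComponent

variable {X : Type*} [TopologicalSpace X] {f : X → ℝ}

/-- The connected component of `z` in its fiber under `f`. -/
def fiberComponent (f : X → ℝ) (z : X) : Set X := connectedComponentIn (f ⁻¹' {f z}) z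

theorem mem_fiberComponent (z : X) : z ∈ fiberComponent f z := mem_connectedComponentIn rfl

theorem apply_eq_of_mem_fiberComponent {y z : X} (h : y ∈ fiberComponent f z) : f y = f z :=
  connectedComponentIn_subset (f ⁻¹' {f z}) z h

theorem isPreconnected_fiberComponent (z : X) : IsPreconnected (fiberComponent f z) :=
  isPreconnected_connectedComponentIn

theorem isClosed_fiberComponent (hf : Continuous f) (z : X) : IsClosed (fiberComponent f z) :=
  isClosed_connectedComponentIn (isClosed_singleton.preimage hf) z

theorem subset_fiberComponent {C : Set X} {z : X} (hC : IsPreconnected C)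
    (hCf : ∀ y ∈ C, f y = f z) (hz : z ∈ C) : C ⊆ fiberComponent f z :=
  hC.subset_connectedComponentIn hz hCf

theorem fiberComponent_eq {y z : X} (h : y ∈ fiberComponent f z) :
    fiberComponent f y = fiberComponent f z := by
  rw [fiberComponent, apply_eq_of_mem_fiberComponent h]
  exact (connectedComponentIn_eq h).symm

theorem fiberComponent_eq_or_disjoint (y z : X) :
    fiberComponent f y = fiberComponent f z ∨
      Disjoint (fiberComponent f y) (fiberComponent f z) := by
  by_cases h : Disjoint (fiberComponent f y) (fiberComponent f z)
  · exact Or.inr h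
  · obtain ⟨t, h1, h2⟩ := not_disjoint_iff.1 h
    exact Or.inl ((fiberComponent_eq h1).symm.trans (fiberComponent_eq h2))

end FiberComponent

section Walls

variable {X : Type*} [NormedAddCommGroup X]

/-- A wall is a component of a fiber over a level in `L n` that misses the closed ball of
radius `n` around `x`. -/
def IsWall (f : X → ℝ) (x : X) (L : ℕ → Set ℝ) (W : Set X) : Prop :=
  ∃ n z, f z ∈ L n ∧ W = fiberComponent f z ∧ Disjoint W (Metric.closedBall x n)

/-- The points that are not strictly behind a wall, as seen from `x`. -/
def visible (f : X → ℝ) (x : X) (L : ℕ → Set ℝ) : Set X :=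
  {y | ∀ W, IsWall f x L W → y ∈ hull x W}

variable {f : X → ℝ} {x : X} {L : ℕ → Set ℝ} {W W' : Set X}

theorem IsWall.notMem (h : IsWall f x L W) : x ∉ W := by
  obtain ⟨n, z, -, -, hd⟩ := h
  exact fun hx => disjoint_left.1 hd hx (Metric.mem_closedBall_self n.cast_nonneg)

theorem IsWall.isClosed (hf : Continuous f) (h : IsWall f x L W) : IsClosed W := by
  obtain ⟨n, z, -, rfl, -⟩ := h
  exact isClosed_fiberComponent hf z

theorem IsWall.isPreconnected (h : IsWall f x L W) : IsPreconnected W := by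
  obtain ⟨n, z, -, rfl, -⟩ := h
  exact isPreconnected_fiberComponent z

theorem IsWall.nonempty (h : IsWall f x L W) : W.Nonempty := by
  obtain ⟨n, z, -, rfl, -⟩ := h
  exact ⟨z, mem_fiberComponent z⟩

theorem IsWall.eq_or_disjoint_fiberComponent (h : IsWall f x L W) (z : X) :
    W = fiberComponent f z ∨ Disjoint W (fiberComponent f z) := by
  obtain ⟨n, y, -, rfl, -⟩ := h
  exact fiberComponent_eq_or_disjoint y z

theorem IsWall.eq_or_disjoint (h : IsWall f x L W) (h' : IsWall f x L W') :
    W = W' ∨ Disjoint W W' := by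
  obtain ⟨n, y, -, rfl, -⟩ := h'
  exact h.eq_or_disjoint_fiberComponent y

theorem self_mem_visible : x ∈ visible f x L := fun _ hW => mem_hull_self hW.notMem

variable [NormedSpace ℝ X]

theorem isClosed_visible (hf : Continuous f) : IsClosed (visible f x L) := by
  have : visible f x L = ⋂ W, ⋂ (_ : IsWall f x L W), hull x W := by
    ext y; simp [visible]
  rw [this]
  exact isClosed_iInter fun W => isClosed_iInter fun hW => isClosed_hull (hW.isClosed hf)

theorem exists_common_wall (hf : Continuous f) {V : Set X} (hV : IsPreconnected V)
    (hVS : V ⊆ (visible f x L)ᶜ) {y y' : X} (hy : y ∈ V) (hy' : y' ∈ V) :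
    ∃ W, IsWall f x L W ∧ y ∉ hull x W ∧ y' ∉ hull x W := by
  refine hV.induction₂' (fun a b => ∃ W, IsWall f x L W ∧ a ∉ hull x W ∧ b ∉ hull x W)
    ?_ ?_ hy hy'
  · intro a ha
    have ha' := hVS ha
    simp only [visible, mem_compl_iff, mem_ofPred_eq, not_forall] at ha'
    obtain ⟨W, hW, haW⟩ := ha'
    filter_upwards [nhdsWithin_le_nhds
      ((isClosed_hull (x := x) (hW.isClosed hf)).isOpen_compl.mem_nhds haW)] with b hb
    exact ⟨⟨W, hW, haW, hb⟩, ⟨W, hW, hb, haW⟩⟩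
  · rintro a b c - - - ⟨W, hW, ha, hb⟩ ⟨W', hW', hb', hc⟩
    rcases hW.eq_or_disjoint hW' with rfl | hd
    · exact ⟨W, hW, ha, hc⟩
    rcases hull_subset_hull_or (hW.isClosed hf) hW.isPreconnected hW.nonempty hW.notMem
      (hW'.isClosed hf) hW'.isPreconnected hW'.nonempty hW'.notMem hd hb hb' with h | h
    · exact ⟨W, hW, ha, fun h' => hc (h h')⟩
    · exact ⟨W', hW', fun h' => ha (h h'), hc⟩

theorem eventually_level_eq (hf : Continuous f)
    (hL : ∀ n t, ∀ᶠ s in 𝓝 t, s ∈ L n → s = t) {z : X} (hz : z ∈ visible f x L) :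
    ∀ᶠ y in 𝓝 z, ∀ W, IsWall f x L W → y ∉ hull x W →
      ∃ n, f z ∈ L n ∧ ∀ w ∈ W, f w = f z := by
  obtain ⟨N, hN⟩ := exists_nat_gt (dist z x + 1)
  have h1 : ∀ᶠ s in 𝓝 (f z), ∀ n ∈ Iio N, s ∈ L n → s = f z :=
    (eventually_all_finite (finite_Iio N)).2 fun n _ => hL n (f z)
  obtain ⟨r, hr, hball⟩ := Metric.eventually_nhds_iff_ball.1 (hf.continuousAt.eventually h1)
  filter_upwards [Metric.ball_mem_nhds z (lt_min hr one_pos)] with y hy W hW hyW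
  have hmeet : ∃ t ∈ Metric.ball z (min r 1), t ∈ W := by
    by_contra! hno
    have hd : Disjoint (Metric.ball z (min r 1)) W := disjoint_left.2 hno
    have hzO := (hz W hW).resolve_left (hno z (Metric.mem_ball_self (lt_min hr one_pos)))
    refine hyW (Or.inr ?_)
    rw [connectedComponentIn_eq hzO]
    exact (convex_ball z _).isPreconnected.subset_connectedComponentIn
      (Metric.mem_ball_self (lt_min hr one_pos)) hd.subset_compl_right hy
  obtain ⟨t, ht, htW⟩ := hmeet
  obtain ⟨n, c, hc, rfl, hd⟩ := hW
  have htx : (n : ℝ) < dist t x := by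
    by_contra! hle
    exact disjoint_left.1 hd htW hle
  have htz : dist t z < 1 := lt_of_lt_of_le ht (min_le_right _ _)
  have hnN : n < N := by
    have : (n : ℝ) < N := by linarith [dist_triangle t z x]
    exact_mod_cast this
  have hft := apply_eq_of_mem_fiberComponent htW
  have hfz : f t = f z := hball t (Metric.ball_subset_ball (min_le_left _ _) ht) n hnN
    (by rwa [hft])
  refine ⟨n, by rw [← hfz, hft]; exact hc, fun w hw => ?_⟩
  rw [apply_eq_of_mem_fiberComponent hw, ← hft, hfz]

theorem frontier_subset_visible (hf : Continuous f) (y : X) :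
    frontier (connectedComponentIn (visible f x L)ᶜ y) ⊆ visible f x L := by
  simpa using frontier_connectedComponentIn_subset
    (isClosed_visible (f := f) (x := x) (L := L) hf).isOpen_compl y

theorem eq_on_frontier (hf : Continuous f)
    (hL : ∀ n t, ∀ᶠ s in 𝓝 t, s ∈ L n → s = t) {y z z' : X}
    (hz : z ∈ frontier (connectedComponentIn (visible f x L)ᶜ y))
    (hz' : z' ∈ frontier (connectedComponentIn (visible f x L)ᶜ y)) :
    f z = f z' ∧ ∃ n, f z ∈ L n := by
  obtain ⟨a, ha, haV⟩ := mem_closure_iff_nhds.1 hz.1 _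
    (eventually_level_eq hf hL (frontier_subset_visible hf y hz))
  obtain ⟨b, hb, hbV⟩ := mem_closure_iff_nhds.1 hz'.1 _
    (eventually_level_eq hf hL (frontier_subset_visible hf y hz'))
  obtain ⟨W, hW, haW, hbW⟩ := exists_common_wall hf isPreconnected_connectedComponentIn
    (connectedComponentIn_subset _ _) haV hbV
  obtain ⟨w, hw⟩ := hW.nonempty
  obtain ⟨n, hn, h1⟩ := ha W hW haW
  obtain ⟨-, -, h2⟩ := hb W hW hbW
  exact ⟨(h1 w hw).symm.trans (h2 w hw), n, hn⟩

theorem fiberComponent_subset_visible (hf : Continuous f) {p q c : X} (hp : p ∈ visible f x L)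
    (hq : q ∈ visible f x L) (h : Separates (fiberComponent f c) p q) :
    fiberComponent f c ⊆ visible f x L := by
  intro v hv W hW
  by_contra hvW
  rcases hW.eq_or_disjoint_fiberComponent c with he | hd
  · rw [← he] at h
    obtain ⟨t, ht, htW⟩ := h.2.2 _ isPreconnected_connectedComponentIn
      ((hp W hW).resolve_left h.1) ((hq W hW).resolve_left h.2.1)
    exact connectedComponentIn_subset _ _ ht htW
  · obtain ⟨t, ht, htC⟩ := h.2.2 _
      (isPreconnected_hull (hW.isClosed hf) hW.isPreconnected hW.nonempty hW.notMem)
      (hp W hW) (hq W hW)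
    exact disjoint_left.1 (disjoint_hull (isPreconnected_fiberComponent c) hd.symm hv hvW) ht htC

end Walls

section Anchors

variable {X : Type*} [NormedAddCommGroup X] [NormedSpace ℝ X] {f : X → ℝ} {x : X}
  {L : ℕ → Set ℝ}

theorem exists_isPreconnected_of_levels (hf : Continuous f) {y : X} (hy : y ∈ visible f x L)
    {n : ℕ} {a b : ℝ} (ha : a ∈ L n) (hb : b ∈ L n) (hay : a < f y) (hyb : f y < b) :
    ∃ P, IsPreconnected P ∧ y ∈ P ∧ (∀ p ∈ P, f p ∈ Icc a b) ∧
      (P ∩ Metric.closedBall x n).Nonempty := by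
  have hab : a ≤ b := (hay.trans hyb).le
  set G := f ⁻¹' Ioo a b with hG
  have hGo : IsOpen G := isOpen_Ioo.preimage hf
  have hyG : y ∈ G := ⟨hay, hyb⟩
  set Q := connectedComponentIn G y with hQ
  have hyQ : y ∈ Q := mem_connectedComponentIn hyG
  have hQp : IsPreconnected (closure Q) := isPreconnected_connectedComponentIn.closure
  have hQf : ∀ p ∈ closure Q, f p ∈ Icc a b := fun p hp =>
    closure_minimal ((connectedComponentIn_subset G y).trans (preimage_mono Ioo_subset_Icc_self))
      (isClosed_Icc.preimage hf) hp
  by_cases hxQ : x ∈ closure Q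
  · exact ⟨closure Q, hQp, subset_closure hyQ, hQf, x, hxQ,
      Metric.mem_closedBall_self n.cast_nonneg⟩
  have hfr : ∀ z ∈ frontier Q, f z = a ∨ f z = b := by
    intro z hz
    have h1 := hQf z hz.1
    have h2 : z ∉ G := frontier_connectedComponentIn_subset hGo y hz
    by_contra! hne
    exact h2 ⟨lt_of_le_of_ne h1.1 hne.1.symm, lt_of_le_of_ne h1.2 hne.2⟩
  have hsep : Separates (frontier Q) x y := by
    refine ⟨fun h => hxQ h.1, fun h => ?_, fun P hP hxP hyP => ?_⟩
    · rcases hfr y h with h | h <;> linarith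
    · exact hP.inter_frontier_nonempty' ⟨y, hyP, hyQ⟩ ⟨x, hxP, fun h => hxQ (subset_closure h)⟩
  obtain ⟨C, hCQ, -, hC, hCsep⟩ := hsep.exists_isPreconnected isClosed_frontier
  obtain ⟨c, -, hc⟩ := hCsep.2.2 univ isPreconnected_univ (mem_univ _) (mem_univ _)
  have hcount : (f '' C).Countable := by
    refine (countable_insert.2 (countable_singleton b) : ({a, b} : Set ℝ).Countable).mono ?_
    rintro _ ⟨z, hz, rfl⟩
    exact hfr z (hCQ hz)
  have hCW : C ⊆ fiberComponent f c := subset_fiberComponent hC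
    (fun z hz => hC.image_subsingleton_of_countable hf hcount hz hc) hc
  have hcf := hfr c (hCQ hc)
  by_cases hd : Disjoint (fiberComponent f c) (Metric.closedBall x n)
  · exfalso
    have hW : IsWall f x L (fiberComponent f c) :=
      ⟨n, c, by rcases hcf with h | h <;> rwa [h], rfl, hd⟩
    have hyW : y ∉ fiberComponent f c := fun h => by
      have := apply_eq_of_mem_fiberComponent h
      rcases hcf with h | h <;> linarith
    obtain ⟨t, ht, htC⟩ := hCsep.2.2 _ isPreconnected_connectedComponentIn
      (mem_connectedComponentIn hW.notMem) ((hy _ hW).resolve_left hyW)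
    exact connectedComponentIn_subset _ _ ht (hCW htC)
  · obtain ⟨k, hk, hkx⟩ := not_disjoint_iff.1 hd
    refine ⟨closure Q ∪ fiberComponent f c,
      hQp.union c (hCQ hc).1 (mem_fiberComponent c) (isPreconnected_fiberComponent c),
      Or.inl (subset_closure hyQ), ?_, k, Or.inr hk, hkx⟩
    rintro p (hp | hp)
    · exact hQf p hp
    · rw [apply_eq_of_mem_fiberComponent hp]
      rcases hcf with h | h <;> rw [h]
      · exact left_mem_Icc.2 hab
      · exact right_mem_Icc.2 hab

theorem frontier_hidden_nonempty {y : X} (hy : y ∉ visible f x L) :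
    (frontier (connectedComponentIn (visible f x L)ᶜ y)).Nonempty :=
  nonempty_frontier_iff.2 ⟨⟨y, mem_connectedComponentIn hy⟩, fun h =>
    connectedComponentIn_subset (visible f x L)ᶜ y (h ▸ mem_univ x) self_mem_visible⟩

variable (hf : Continuous f) (hL : ∀ n t, ∀ᶠ s in 𝓝 t, s ∈ L n → s = t)
  (hgrid : ∀ n t, ∃ a ∈ L n, ∃ b ∈ L n, t - 2 / ((n : ℝ) + 1) ≤ a ∧ a < t ∧ t < b ∧
    b ≤ t + 2 / ((n : ℝ) + 1))

include hf hL hgrid in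
theorem exists_anchor_of_mem_visible {y : X} (hy : y ∈ visible f x L) (n : ℕ) :
    ∃ k ∈ Metric.closedBall x n ∩ visible f x L, ∃ P, IsPreconnected P ∧ y ∈ P ∧ k ∈ P ∧
      ∀ p ∈ P ∩ visible f x L, |f p - f y| ≤ 2 / ((n : ℝ) + 1) := by
  obtain ⟨a, ha, b, hb, ha', hay, hyb, hb'⟩ := hgrid n (f y)
  obtain ⟨P, hP, hyP, hPf, k, hkP, hkx⟩ := exists_isPreconnected_of_levels hf hy ha hb hay hyb
  have hPf' : ∀ p ∈ P, |f p - f y| ≤ 2 / ((n : ℝ) + 1) := fun p hp => by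
    have := hPf p hp
    rw [abs_le]
    constructor <;> linarith [this.1, this.2]
  by_cases hk : k ∈ visible f x L
  · exact ⟨k, ⟨hkx, hk⟩, P, hP, hyP, hkP, fun p hp => hPf' p hp.1⟩
  set V := connectedComponentIn (visible f x L)ᶜ k with hV
  have hkV : k ∈ V := mem_connectedComponentIn hk
  have hVS : V ⊆ (visible f x L)ᶜ := connectedComponentIn_subset _ _
  obtain ⟨z, hzP, hz⟩ := hP.inter_frontier_nonempty' ⟨k, hkP, hkV⟩ ⟨y, hyP, fun h => hVS h hy⟩
  obtain ⟨k', hk's, hk'⟩ := (convex_segment k x).isPreconnected.inter_frontier_nonempty'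
    ⟨k, left_mem_segment ℝ k x, hkV⟩ ⟨x, right_mem_segment ℝ k x, fun h => hVS h self_mem_visible⟩
  have hk'x : k' ∈ Metric.closedBall x n := (convex_closedBall x n).segment_subset hkx
    (Metric.mem_closedBall_self n.cast_nonneg) hk's
  refine ⟨k', ⟨hk'x, frontier_subset_visible hf k hk'⟩, P ∪ insert k' V, ?_, Or.inl hyP,
    Or.inr (mem_insert _ _), ?_⟩
  · exact hP.union k hkP (mem_insert_of_mem _ hkV)
      (isPreconnected_connectedComponentIn.subset_closure (subset_insert _ _)
        (insert_subset hk'.1 subset_closure))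
  · rintro p ⟨hp | rfl | hp, hpS⟩
    · exact hPf' p hp
    · rw [(eq_on_frontier hf hL hk' hz).1]
      exact hPf' z hzP
    · exact (hVS hp hpS).elim

include hf hL hgrid in
theorem exists_anchor {g : X → ℝ} (hg : ∀ y ∈ visible f x L, g y = f y)
    (hg' : ∀ y ∉ visible f x L,
      ∃ z ∈ frontier (connectedComponentIn (visible f x L)ᶜ y), g y = f z) (y : X) (n : ℕ) :
    ∃ k ∈ Metric.closedBall x n ∩ visible f x L, ∃ P, IsPreconnected P ∧ y ∈ P ∧ k ∈ P ∧
      ∀ p ∈ P ∩ visible f x L, |f p - g y| ≤ 2 / ((n : ℝ) + 1) := by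
  by_cases hy : y ∈ visible f x L
  · rw [hg y hy]
    exact exists_anchor_of_mem_visible hf hL hgrid hy n
  obtain ⟨z, hz, hgz⟩ := hg' y hy
  obtain ⟨k, hk, P, hP, hzP, hkP, hPf⟩ :=
    exists_anchor_of_mem_visible hf hL hgrid (frontier_subset_visible hf y hz) n
  refine ⟨k, hk, P ∪ insert z (connectedComponentIn (visible f x L)ᶜ y), ?_,
    Or.inr (mem_insert_of_mem _ (mem_connectedComponentIn hy)), Or.inl hkP, ?_⟩
  · exact hP.union z hzP (mem_insert _ _)
      (isPreconnected_connectedComponentIn.subset_closure (subset_insert _ _)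
        (insert_subset hz.1 subset_closure))
  · rw [hgz]
    rintro p ⟨hp | rfl | hp, hpS⟩
    · exact hPf p ⟨hp, hpS⟩
    · exact hPf p ⟨hzP, hpS⟩
    · exact (connectedComponentIn_subset _ _ hp hpS).elim

end Anchors

section UniformContinuity

variable {X : Type*} [NormedAddCommGroup X] [NormedSpace ℝ X] {f : X → ℝ}

theorem exists_fiberComponent_separates (hf : Continuous f) {p q : X} {c : ℝ} (hp : f p < c)
    (hq : c < f q) : ∃ z, f z = c ∧ Separates (fiberComponent f z) p q := by
  obtain ⟨C, hC, -, hCp, hCs⟩ := exists_level_separator hf hp hq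
  obtain ⟨z, -, hz⟩ := hCs.2.2 univ isPreconnected_univ (mem_univ _) (mem_univ _)
  have hzc : f z = c := hC hz
  refine ⟨z, hzc, hCs.mono (subset_fiberComponent hCp (fun y hy => ?_) hz) ?_ ?_⟩
  · rw [hzc]
    exact hC hy
  · intro h
    rw [← hzc, apply_eq_of_mem_fiberComponent h] at hp
    exact hp.false
  · intro h
    rw [← hzc, apply_eq_of_mem_fiberComponent h] at hq
    exact hq.false

theorem HasDCF.exists_uniform_gap (hf : Continuous f) (h : HasDCF f) {t : Set X}
    (ht : t.Finite) : ∃ η > 0, ∀ p ∈ t, ∀ q ∈ t, f p < f q →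
      ∃ z₁ z₂, f z₁ = f p + (f q - f p) / 3 ∧ f z₂ = f q - (f q - f p) / 3 ∧
        Separates (fiberComponent f z₁) p q ∧ Separates (fiberComponent f z₂) p q ∧
        ∀ a ∈ fiberComponent f z₁, ∀ b ∈ fiberComponent f z₂, η ≤ dist a b := by
  have key : ∀ᶠ η : ℝ in 𝓝[>] 0, ∀ p ∈ t, ∀ q ∈ t, f p < f q →
      ∃ z₁ z₂, f z₁ = f p + (f q - f p) / 3 ∧ f z₂ = f q - (f q - f p) / 3 ∧
        Separates (fiberComponent f z₁) p q ∧ Separates (fiberComponent f z₂) p q ∧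
        ∀ a ∈ fiberComponent f z₁, ∀ b ∈ fiberComponent f z₂, η ≤ dist a b := by
    refine (eventually_all_finite ht).2 fun p _ => (eventually_all_finite ht).2 fun q _ => ?_
    by_cases hpq : f p < f q
    swap
    · exact Eventually.of_forall fun _ h => (hpq h).elim
    obtain ⟨z₁, hz₁, hs₁⟩ := exists_fiberComponent_separates hf (p := p) (q := q)
      (c := f p + (f q - f p) / 3) (by linarith) (by linarith)
    obtain ⟨z₂, hz₂, hs₂⟩ := exists_fiberComponent_separates hf (p := p) (q := q)
      (c := f q - (f q - f p) / 3) (by linarith) (by linarith)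
    obtain ⟨ε, hε, hd⟩ := h (f z₁) (f z₂) (by rw [hz₁, hz₂]; intro h; linarith)
      (fiberComponent f z₁) (fiberComponent f z₂) ⟨z₁, mem_fiberComponent z₁⟩
      ⟨z₂, mem_fiberComponent z₂⟩ (isPreconnected_fiberComponent z₁)
      (isPreconnected_fiberComponent z₂) (fun _ => apply_eq_of_mem_fiberComponent)
      (fun _ => apply_eq_of_mem_fiberComponent)
    filter_upwards [Ioo_mem_nhdsGT hε] with η hη _
    exact ⟨z₁, z₂, hz₁, hz₂, hs₁, hs₂, fun a ha b hb => hη.2.le.trans (hd a ha b hb)⟩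
  obtain ⟨η, hη, hη0⟩ := (key.and self_mem_nhdsWithin).exists
  exact ⟨η, hη0, hη⟩

theorem HasDCF.uniformContinuous_of_anchors [ProperSpace X] (hf : Continuous f) (h : HasDCF f)
    {x : X} {S : Set X} (hS : ∀ p ∈ S, ∀ q ∈ S, ∀ z, Separates (fiberComponent f z) p q →
      fiberComponent f z ⊆ S) {g : X → ℝ}
    (hg : ∀ y, ∀ n : ℕ, ∃ k ∈ Metric.closedBall x n ∩ S, ∃ P, IsPreconnected P ∧ y ∈ P ∧ k ∈ P ∧
      ∀ p ∈ P ∩ S, |f p - g y| ≤ 2 / ((n : ℝ) + 1)) : UniformContinuous g := by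
  rw [Metric.uniformContinuous_iff]
  intro ε hε
  obtain ⟨δ, hδ, hδε⟩ : ∃ δ > 0, ε = 30 * δ := ⟨ε / 30, by positivity, by ring⟩
  obtain ⟨N, hN⟩ := exists_nat_one_div_lt hδ
  have hN' : 2 / ((N : ℝ) + 1) ≤ 2 * δ := by
    have : 2 / ((N : ℝ) + 1) = 2 * (1 / ((N : ℝ) + 1)) := by ring
    linarith
  have hK : IsCompact (Metric.closedBall x (N : ℝ)) := isCompact_closedBall x N
  obtain ⟨r, hr, hfr⟩ := Metric.uniformContinuousOn_iff.1
    (hK.uniformContinuousOn_of_continuous hf.continuousOn) δ hδ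
  obtain ⟨t, htK, htf, ht⟩ := Metric.finite_approx_of_totallyBounded
    (hK.totallyBounded.subset inter_subset_left : TotallyBounded (Metric.closedBall x N ∩ S)) r hr
  have net : ∀ y, ∃ p ∈ t, ∃ T, IsPreconnected T ∧ y ∈ T ∧ p ∈ T ∧
      ∀ s ∈ T ∩ S, |f s - g y| ≤ 3 * δ := by
    intro y
    obtain ⟨k, hk, P, hP, hyP, hkP, hPf⟩ := hg y N
    obtain ⟨p, hp, hkp⟩ := mem_iUnion₂.1 (ht hk)
    have hkf := hPf k ⟨hkP, hk.2⟩
    refine ⟨p, hp, P ∪ segment ℝ k p, hP.union k hkP (left_mem_segment ℝ k p)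
      (convex_segment k p).isPreconnected, Or.inl hyP, Or.inr (right_mem_segment ℝ k p), ?_⟩
    rintro s ⟨hs | hs, hsS⟩
    · linarith [hPf s ⟨hs, hsS⟩]
    · have hsr : dist s k < r := lt_of_le_of_lt
        ((convex_closedBall k (dist k p)).segment_subset
          (Metric.mem_closedBall_self dist_nonneg) (dist_comm p k).le hs) hkp
      have hsk := hfr s ((convex_closedBall x N).segment_subset hk.1 (htK hp).1 hs) k hk.1 hsr
      rw [Real.dist_eq] at hsk
      linarith [abs_sub_le (f s) (f k) (g y)]
  obtain ⟨η, hη, hgap⟩ := h.exists_uniform_gap hf htf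
  have main : ∀ y y', dist y y' < η → g y' < g y + ε := by
    intro y y' hyy'
    by_contra! hge
    obtain ⟨p, hp, T, hT, hyT, hpT, hTf⟩ := net y
    obtain ⟨q, hq, T', hT', hyT', hqT', hTf'⟩ := net y'
    have hpf := abs_le.1 (hTf p ⟨hpT, (htK hp).2⟩)
    have hqf := abs_le.1 (hTf' q ⟨hqT', (htK hq).2⟩)
    obtain ⟨z₁, z₂, hz₁, hz₂, hs₁, hs₂, hd⟩ := hgap p hp q hq (by linarith [hpf.2, hqf.1])
    have meets : ∀ z, g y + 3 * δ < f z → f z < g y' - 3 * δ →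
        Separates (fiberComponent f z) p q → ∃ a ∈ fiberComponent f z, a ∈ segment ℝ y y' := by
      intro z h1 h2 hs
      have hzS := hS p (htK hp).2 q (htK hq).2 z hs
      obtain ⟨a, ha, haz⟩ := hs.2.2 ((T ∪ segment ℝ y y') ∪ T')
        ((hT.union y hyT (left_mem_segment ℝ y y') (convex_segment y y').isPreconnected).union y'
          (Or.inr (right_mem_segment ℝ y y')) hyT' hT') (Or.inl (Or.inl hpT)) (Or.inr hqT')
      have haf := apply_eq_of_mem_fiberComponent haz
      rcases ha with (ha | ha) | ha
      · linarith [(abs_le.1 (hTf a ⟨ha, hzS haz⟩)).2]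
      · exact ⟨a, haz, ha⟩
      · linarith [(abs_le.1 (hTf' a ⟨ha, hzS haz⟩)).1]
    obtain ⟨a, ha, has⟩ := meets z₁ (by linarith [hpf.1, hpf.2, hqf.1, hqf.2])
      (by linarith [hpf.1, hpf.2, hqf.1, hqf.2]) hs₁
    obtain ⟨b, hb, hbs⟩ := meets z₂ (by linarith [hpf.1, hpf.2, hqf.1, hqf.2])
      (by linarith [hpf.1, hpf.2, hqf.1, hqf.2]) hs₂
    have hab : dist a b ≤ dist y y' := by
      rw [← convexHull_pair] at has hbs
      obtain ⟨a', ha', b', hb', h'⟩ := convexHull_exists_dist_ge2 has hbs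
      refine h'.trans ?_
      rcases ha' with rfl | rfl <;> rcases hb' with rfl | rfl <;> simp [dist_comm]
    linarith [hd a ha b hb]
  refine ⟨η, hη, fun y y' hyy' => ?_⟩
  rw [Real.dist_eq, abs_lt]
  constructor
  · linarith [main y y' hyy']
  · linarith [main y' y (by rwa [dist_comm])]

end UniformContinuity

section Levels

/-- A grid of points of `ℝ`, one in each cell of length `1 / (n + 1)`. -/
theorem exists_levels (A : Set ℝ) (hA : ∀ a b, a < b → (A ∩ Ioo a b).Nonempty) :
    ∃ L : ℕ → Set ℝ, (∀ n, L n ⊆ A) ∧ (∀ n t, ∀ᶠ s in 𝓝 t, s ∈ L n → s = t) ∧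
      ∀ n t, ∃ a ∈ L n, ∃ b ∈ L n, t - 2 / ((n : ℝ) + 1) ≤ a ∧ a < t ∧ t < b ∧
        b ≤ t + 2 / ((n : ℝ) + 1) := by
  have hcell : ∀ (n : ℕ) (j : ℤ), ∃ e ∈ A, (j : ℝ) < e * (n + 1) ∧ e * (n + 1) < j + 1 := by
    intro n j
    have hn : (0 : ℝ) < n + 1 := by positivity
    obtain ⟨e, heA, he⟩ := hA (j / (n + 1)) ((j + 1) / (n + 1))
      (div_lt_div_of_pos_right (lt_add_one _) hn)
    exact ⟨e, heA, (div_lt_iff₀ hn).1 he.1, (lt_div_iff₀ hn).1 he.2⟩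
  choose e heA he he' using hcell
  refine ⟨fun n => range (e n), fun n => ?_, fun n t => ?_, fun n t => ?_⟩
  · rintro _ ⟨j, rfl⟩
    exact heA n j
  · set F : Set ℝ := (e n '' Icc (⌊t * (n + 1)⌋ - 1) (⌊t * (n + 1)⌋ + 1)) \ {t}
    have hFf : F.Finite := ((finite_Icc _ _).image _).subset sdiff_subset
    have h1 : ∀ᶠ s in 𝓝 t, s ∉ F := hFf.isClosed.isOpen_compl.mem_nhds (fun h => h.2 rfl)
    have hc : ContinuousAt (fun s : ℝ => s * ((n : ℝ) + 1)) t := by fun_prop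
    have h2 : ∀ᶠ s in 𝓝 t, s * ((n : ℝ) + 1) ∈
        Ioo ((⌊t * ((n : ℝ) + 1)⌋ : ℝ) - 1) ((⌊t * ((n : ℝ) + 1)⌋ : ℝ) + 1) :=
      hc.eventually (Ioo_mem_nhds (by linarith [Int.floor_le (t * ((n : ℝ) + 1))])
        (Int.lt_floor_add_one _))
    filter_upwards [h1, h2] with s hs hs'
    rintro ⟨j, rfl⟩
    by_contra hne
    refine hs ⟨mem_image_of_mem _ ⟨?_, ?_⟩, hne⟩
    · have : (⌊t * (n + 1)⌋ : ℝ) - 1 < j + 1 := hs'.1.trans (he' n j)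
      have : ⌊t * (n + 1)⌋ - 1 < j + 1 := by exact_mod_cast this
      omega
    · have : (j : ℝ) < (⌊t * (n + 1)⌋ : ℝ) + 1 := (he n j).trans hs'.2
      have : j < ⌊t * (n + 1)⌋ + 1 := by exact_mod_cast this
      omega
  · have hn : (0 : ℝ) < n + 1 := by positivity
    set j := ⌊t * (n + 1)⌋
    have hj1 : (j : ℝ) ≤ t * (n + 1) := Int.floor_le _
    have hj2 : t * (n + 1) < j + 1 := Int.lt_floor_add_one _
    have a1 := he n (j - 1)
    have a2 := he' n (j - 1)
    have b1 := he n (j + 1)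
    have b2 := he' n (j + 1)
    push_cast at a1 a2 b1 b2
    have hd : 2 / ((n : ℝ) + 1) * (n + 1) = 2 := by field_simp
    refine ⟨e n (j - 1), ⟨_, rfl⟩, e n (j + 1), ⟨_, rfl⟩, ?_, ?_, ?_, ?_⟩
    · exact le_of_mul_le_mul_right (by linarith) hn
    · exact lt_of_mul_lt_mul_right (by linarith) hn.le
    · exact lt_of_mul_lt_mul_right (by linarith) hn.le
    · exact le_of_mul_le_mul_right (by linarith) hn

end Levels

section Main

variable {X : Type*} [NormedAddCommGroup X] [NormedSpace ℝ X] [ProperSpace X] {f : X → ℝ}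

theorem HasDCF.isWUAd (hf : Continuous f) (h : HasDCF f) : IsWUAd f := by
  intro x M hM
  obtain ⟨L, hLA, hL, hgrid⟩ := exists_levels (f '' M ∪ (range f)ᶜ) fun a b hab => by
    by_cases hr : (f ⁻¹' Ioo a b).Nonempty
    · obtain ⟨y, hy, hyM⟩ := hM.inter_open_nonempty _ (isOpen_Ioo.preimage hf) hr
      exact ⟨f y, Or.inl (mem_image_of_mem f hyM), hy⟩
    · obtain ⟨c, hc⟩ := nonempty_Ioo.2 hab
      exact ⟨c, Or.inr fun ⟨y, hy⟩ => hr ⟨y, by rwa [mem_preimage, hy]⟩, hc⟩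
  have hex : ∀ y, ∃ v : ℝ, (y ∈ visible f x L → v = f y) ∧ (y ∉ visible f x L →
      ∃ z ∈ frontier (connectedComponentIn (visible f x L)ᶜ y), v = f z) := fun y => by
    by_cases hy : y ∈ visible f x L
    · exact ⟨f y, fun _ => rfl, fun h => (h hy).elim⟩
    · obtain ⟨z, hz⟩ := frontier_hidden_nonempty hy
      exact ⟨f z, fun h => (hy h).elim, fun _ => ⟨z, hz, rfl⟩⟩
  choose g hg hg' using hex
  refine ⟨g, h.uniformContinuous_of_anchors hf
    (fun p hp q hq z => fiberComponent_subset_visible hf hp hq)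
    (exists_anchor hf hL hgrid hg hg'), hg x self_mem_visible, ?_⟩
  rintro _ ⟨y, hyM, rfl⟩
  by_cases hy : y ∈ visible f x L
  · exact ⟨y, hyM, (hg y hy).symm⟩
  · obtain ⟨z, hz, hgz⟩ := hg' y hy
    obtain ⟨n, hn⟩ := (eq_on_frontier hf hL hz hz).2
    rw [hgz]
    exact (hLA n hn).resolve_right fun h => h (mem_range_self z)

end Main

/-- For continuous functions on Euclidean `m`-space, WUA_d coincides with DCF. -/
theorem stmt5 (m : ℕ) (f : EuclideanSpace ℝ (Fin m) → ℝ) (hf : Continuous f) :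
    IsWUAd f ↔ HasDCF f :=
  ⟨fun h => h.hasDCF hf, fun h => h.isWUAd hf⟩
end

section
/- Every complete thin metric space has the compact separation property (CSP). -/
/-- The uniform quasi-component of `y` in `Y`: the intersection of all subsets
`U ⊆ Y` containing `y` that are at positive distance from `Y \ U`. -/
def uniformQuasiComponent {X : Type*} [MetricSpace X] (Y : Set X) (y : X) : Set X :=
  ⋂₀ {U : Set X | U ⊆ Y ∧ y ∈ U ∧ ∃ ε > (0 : ℝ), ∀ u ∈ U, ∀ v ∈ Y \ U, ε ≤ dist u v}

/-- A metric space is thin if for every closed subset `Y` and every `y ∈ Y` the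
uniform quasi-component of `y` in `Y` is connected. -/
def IsThin (X : Type*) [MetricSpace X] : Prop :=
  ∀ Y : Set X, IsClosed Y → ∀ y ∈ Y, IsConnected (uniformQuasiComponent Y y)

/-- Two sets `P`, `Q` are separated if the closure of each misses the other. -/
def IsSeparatedPair {X : Type*} [TopologicalSpace X] (P Q : Set X) : Prop :=
  closure P ∩ Q = ∅ ∧ P ∩ closure Q = ∅

/-- `S` separates `A` and `B` if the complement of `S` is the union of two disjoint
separated sets, one containing `A` and the other containing `B`. -/
def SeparatesSets {X : Type*} [TopologicalSpace X] (S A B : Set X) : Prop :=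
  ∃ P Q : Set X, P ∪ Q = Sᶜ ∧ Disjoint P Q ∧ IsSeparatedPair P Q ∧ A ⊆ P ∧ B ⊆ Q

/-- A metric space has the compact separation property (CSP) if for any two disjoint
closed connected subsets `A`, `B` there is a compact set `K` disjoint from `A ∪ B`
such that every open neighbourhood of `K` disjoint from `A ∪ B` separates `A` and
`B`. -/
def HasCSP (X : Type*) [MetricSpace X] : Prop :=
  ∀ A B : Set X, IsClosed A → IsClosed B → IsConnected A → IsConnected B →
    Disjoint A B →
    ∃ K : Set X, IsCompact K ∧ Disjoint K (A ∪ B) ∧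
      ∀ V : Set X, IsOpen V → K ⊆ V → Disjoint V (A ∪ B) → SeparatesSets V A B

open Set Metric Filter Topology

/-- One step of length less than `ε` inside `Z`. -/
def ChainStep {X : Type*} [MetricSpace X] (Z : Set X) (ε : ℝ) (x y : X) : Prop :=
  x ∈ Z ∧ y ∈ Z ∧ dist x y < ε

/-- The complement of the open set `U` splits into two disjoint closed sets,
one containing `A` and the other containing `B`. -/
def OpenSeparates {X : Type*} [TopologicalSpace X] (A B U : Set X) : Prop :=
  IsOpen U ∧ ∃ P Q : Set X, IsClosed P ∧ IsClosed Q ∧ Disjoint P Q ∧ P ∪ Q = Uᶜ ∧ A ⊆ P ∧ B ⊆ Q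

section Chains

variable {X : Type*} [MetricSpace X]

theorem ChainStep.mono {Z Z' : Set X} {ε ε' : ℝ} (hZ : Z ⊆ Z') (hε : ε ≤ ε') {x y : X}
    (h : ChainStep Z ε x y) : ChainStep Z' ε' x y :=
  ⟨hZ h.1, hZ h.2.1, h.2.2.trans_le hε⟩

/-- A chain uses only finitely many points. -/
theorem exists_finset_chain {Z : Set X} {ε : ℝ} {a b : X}
    (h : Relation.ReflTransGen (ChainStep Z ε) a b) :
    ∃ C : Finset X, (C : Set X) ⊆ Z ∧ Relation.ReflTransGen (ChainStep (C : Set X) ε) a b := by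
  classical
  induction h with
  | refl => exact ⟨∅, by simp, .refl⟩
  | @tail b c _ hbc ih =>
    obtain ⟨C, hC, hch⟩ := ih
    refine ⟨insert b (insert c C), ?_, ?_⟩
    · intro x hx
      simp only [Finset.coe_insert, mem_insert_iff, Finset.mem_coe] at hx
      rcases hx with rfl | rfl | hx
      exacts [hbc.1, hbc.2.1, hC hx]
    · refine (Relation.ReflTransGen.mono (fun x y hxy => hxy.mono ?_ le_rfl) _ _ hch).tail ⟨by simp, by simp, hbc.2.2⟩
      intro x hx
      simp only [Finset.coe_insert, mem_insert_iff]
      exact Or.inr (Or.inr hx)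

/-- Points joined by arbitrarily fine chains lie in the same uniform quasi-component. -/
theorem mem_uniformQuasiComponent_of_chains {Y : Set X} {a b : X}
    (h : ∀ ε > 0, Relation.ReflTransGen (ChainStep Y ε) a b) :
    b ∈ uniformQuasiComponent Y a := by
  rintro U ⟨_, haU, ε, hε, hgap⟩
  have hch := h ε hε
  clear h
  induction hch with
  | refl => exact haU
  | @tail b c _ hbc ih =>
    by_contra hc
    exact absurd (hgap _ ih c ⟨hbc.2.1, hc⟩) (not_le.2 hbc.2.2)

theorem uniformQuasiComponent_subset {Y : Set X} {a : X} (ha : a ∈ Y) :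
    uniformQuasiComponent Y a ⊆ Y :=
  sInter_subset_of_mem ⟨subset_rfl, ha, 1, one_pos, fun _ _ _ hv => absurd hv.1 hv.2⟩

theorem mem_uniformQuasiComponent_self (Y : Set X) (a : X) :
    a ∈ uniformQuasiComponent Y a := fun _ hU => hU.2.1

/-- A preconnected set contained in the union of two disjoint closed sets and meeting one of them
lies in that one. -/
theorem IsPreconnected.subset_left_of_subset_union_closed {S P Q : Set X} (hS : IsPreconnected S)
    (hP : IsClosed P) (hQ : IsClosed Q) (hPQ : Disjoint P Q) (hSPQ : S ⊆ P ∪ Q) {a : X}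
    (haS : a ∈ S) (haP : a ∈ P) : S ⊆ P := by
  have hdis : S ∩ (P ∩ Q) = ∅ := by rw [hPQ.inter_eq]; simp
  rcases isPreconnected_iff_subset_of_disjoint_closed.1 hS P Q hP hQ hSPQ hdis with h | h
  · exact h
  · exact absurd (h haS) (disjoint_left.1 hPQ haP)

/-- If two points of `Z` cannot be joined by an `ε`-chain in the closed set `Z`, then `Zᶜ`
separates any connected subsets of `Z` containing them. -/
theorem openSeparates_of_not_chain {A B Z : Set X} (hZ : IsClosed Z) (hA : IsPreconnected A)
    (hB : IsPreconnected B) (hAZ : A ⊆ Z) (hBZ : B ⊆ Z) {a b : X} (ha : a ∈ A) (hb : b ∈ B)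
    {ε : ℝ} (hε : 0 < ε) (h : ¬ Relation.ReflTransGen (ChainStep Z ε) a b) :
    OpenSeparates A B Zᶜ := by
  set P : Set X := {x | x ∈ Z ∧ Relation.ReflTransGen (ChainStep Z ε) a x}
  set Q : Set X := {x | x ∈ Z ∧ ¬ Relation.ReflTransGen (ChainStep Z ε) a x}
  have hPc : IsClosed P := by
    refine isClosed_of_closure_subset fun x hx => ?_
    have hxZ : x ∈ Z := closure_minimal (fun y hy => hy.1) hZ hx
    obtain ⟨y, hy, hxy⟩ := Metric.mem_closure_iff.1 hx ε hε
    exact ⟨hxZ, hy.2.tail ⟨hy.1, hxZ, by rwa [dist_comm]⟩⟩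
  have hQc : IsClosed Q := by
    refine isClosed_of_closure_subset fun x hx => ?_
    have hxZ : x ∈ Z := closure_minimal (fun y hy => hy.1) hZ hx
    obtain ⟨y, hy, hxy⟩ := Metric.mem_closure_iff.1 hx ε hε
    exact ⟨hxZ, fun hch => hy.2 (hch.tail ⟨hxZ, hy.1, hxy⟩)⟩
  have hdis : Disjoint P Q := disjoint_left.2 fun x hx hx' => hx'.2 hx.2
  have hun : P ∪ Q = Z := by
    ext x
    simp only [P, Q, mem_union, mem_ofPred_eq]
    tauto
  refine ⟨hZ.isOpen_compl, P, Q, hPc, hQc, hdis, by rw [hun, compl_compl], ?_, ?_⟩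
  · exact hA.subset_left_of_subset_union_closed hPc hQc hdis (hun ▸ hAZ) ha ⟨hAZ ha, .refl⟩
  · exact hB.subset_left_of_subset_union_closed hQc hPc hdis.symm
      (by rw [union_comm, hun]; exact hBZ) hb ⟨hBZ hb, h⟩

/-- In a thin space, a set all of whose points outside `U` come from a separated complement and
all of whose points in `U` are isolated cannot carry arbitrarily fine chains from `A` to `B`. -/
theorem IsThin.not_chains_of_isolated (hthin : IsThin X) {A B U Y : Set X}
    (hU : OpenSeparates A B U) (hUY : Uᶜ ⊆ Y)
    (hiso : ∀ p ∈ U, ∃ W, IsOpen W ∧ p ∈ W ∧ W ∩ Y ⊆ {p}) {a b : X} (ha : a ∈ A) (hb : b ∈ B) :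
    ¬ ∀ ε > 0, Relation.ReflTransGen (ChainStep Y ε) a b := by
  intro hch
  obtain ⟨-, P, Q, hP, hQ, hPQ, hun, hAP, hBQ⟩ := hU
  have haU : a ∈ Uᶜ := hun ▸ Or.inl (hAP ha)
  have hY : IsClosed Y := by
    refine ⟨isOpen_iff_forall_mem_open.2 fun p hp => ?_⟩
    obtain ⟨W, hW, hpW, hWY⟩ := hiso p (by by_contra h; exact hp (hUY h))
    refine ⟨W, fun q hq hqY => ?_, hW, hpW⟩
    have hqp : q = p := hWY ⟨hq, hqY⟩
    exact hp (hqp ▸ hqY)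
  have hconn := (hthin Y hY a (hUY haU)).isPreconnected
  have hsub : uniformQuasiComponent Y a ⊆ P ∪ Q := by
    rw [hun]
    intro p hp hpU
    obtain ⟨W, hW, hpW, hWY⟩ := hiso p hpU
    obtain ⟨q, hq, hqW, hqp⟩ := hconn W {p}ᶜ hW isOpen_compl_singleton
      (fun q _ => by by_cases h : q = p <;> simp [h, hpW])
      ⟨p, hp, hpW⟩ ⟨a, mem_uniformQuasiComponent_self Y a, fun h => haU (by
        rw [mem_singleton_iff] at h; rwa [h])⟩
    exact hqp (hWY ⟨hqW, uniformQuasiComponent_subset (hUY haU) hq⟩)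
  have := hconn.subset_left_of_subset_union_closed hP hQ hPQ hsub
    (mem_uniformQuasiComponent_self Y a) (hAP ha) (mem_uniformQuasiComponent_of_chains hch)
  exact disjoint_left.1 hPQ this (hBQ hb)

/-- A radius at most `r` for which the closed ball around a point of `U` stays inside `U`. -/
noncomputable def innerRadius (U : Set X) (r : ℝ) (x : X) : ℝ := min r (infDist x Uᶜ / 2)

theorem innerRadius_pos {U : Set X} (hU : IsOpen U) (hne : (Uᶜ).Nonempty) {r : ℝ} (hr : 0 < r)
    {x : X} (hx : x ∈ U) : 0 < innerRadius U r x :=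
  lt_min hr (half_pos ((hU.isClosed_compl.notMem_iff_infDist_pos hne).1 (by simpa using hx)))

theorem innerRadius_le_add_dist (U : Set X) (r : ℝ) (x y : X) :
    innerRadius U r x ≤ innerRadius U r y + dist x y := by
  have h := infDist_le_infDist_add_dist (s := Uᶜ) (x := x) (y := y)
  have hd : 0 ≤ dist x y := dist_nonneg
  unfold innerRadius
  rcases min_cases r (infDist y Uᶜ / 2) with ⟨h1, -⟩ | ⟨h1, -⟩ <;> rw [h1]
  · exact (min_le_left _ _).trans (by linarith)
  · exact (min_le_right _ _).trans (by linarith)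

theorem closure_ball_innerRadius_subset (U : Set X) (r : ℝ) (x : X) :
    closure (ball x (innerRadius U r x)) ⊆ U := by
  rcases le_or_gt (innerRadius U r x) 0 with h0 | h0
  · simp [ball_eq_empty.2 h0]
  intro y hy
  by_contra hyU
  have h1 : dist y x ≤ innerRadius U r x := closure_ball_subset_closedBall hy
  have h2 : infDist x Uᶜ ≤ dist x y := infDist_le_dist_of_mem hyU
  have h3 : innerRadius U r x ≤ infDist x Uᶜ / 2 := min_le_right _ _
  rw [dist_comm] at h1
  linarith

/-- Points of a sequence of finite sets, each avoiding the inner balls around the points of the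
earlier ones, are isolated inside `U`. -/
theorem exists_isOpen_inter_subset_singleton {U : Set X} (hU : IsOpen U) (hne : (Uᶜ).Nonempty)
    {r : ℝ} (hr : 0 < r) {C : ℕ → Finset X}
    (hC : ∀ m n, m < n → ∀ x ∈ C m, ∀ y ∈ C n, y ∉ ball x (innerRadius U r x))
    {p : X} (hp : p ∈ U) :
    ∃ W, IsOpen W ∧ p ∈ W ∧ W ∩ (Uᶜ ∪ ⋃ n, (C n : Set X)) ⊆ {p} := by
  set ρ := innerRadius U r p
  have hρ : 0 < ρ := innerRadius_pos hU hne hr hp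
  have hclose : ∀ m n, m < n → ∀ x ∈ C m, ∀ y ∈ C n, x ∈ ball p (ρ / 4) →
      y ∉ ball p (ρ / 4) := by
    intro m n hmn x hx y hy hxp hyp
    apply hC m n hmn x hx y hy
    rw [mem_ball] at *
    have h1 := innerRadius_le_add_dist U r p x
    have h2 := dist_triangle_right y x p
    rw [dist_comm p x] at h1
    change ρ ≤ _ at h1
    linarith
  have hfin : (ball p (ρ / 4) ∩ ⋃ n, (C n : Set X)).Finite := by
    by_cases hex : ∃ n, ∃ x ∈ C n, x ∈ ball p (ρ / 4)
    · obtain ⟨n, x, hx, hxp⟩ := hex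
      refine (C n).finite_toSet.subset ?_
      rintro y ⟨hyp, hy⟩
      obtain ⟨m, hym⟩ := mem_iUnion.1 hy
      rcases lt_trichotomy m n with h | rfl | h
      · exact absurd hxp (hclose m n h y hym x hx hyp)
      · exact hym
      · exact absurd hyp (hclose n m h x hx y hym hxp)
    · push Not at hex
      refine Set.finite_empty.subset ?_
      rintro y ⟨hyp, hy⟩
      obtain ⟨m, hym⟩ := mem_iUnion.1 hy
      exact hex m y hym hyp
  refine ⟨U ∩ ball p (ρ / 4) ∩ ((ball p (ρ / 4) ∩ ⋃ n, (C n : Set X)) \ {p})ᶜ,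
    (hU.inter isOpen_ball).inter (hfin.subset sdiff_subset).isClosed.isOpen_compl,
    ⟨⟨hp, mem_ball_self (by positivity)⟩, fun h => h.2 rfl⟩, ?_⟩
  rintro q ⟨⟨⟨hqU, hqb⟩, hq⟩, hqY⟩
  rcases hqY with hqY | hqY
  · exact absurd hqU hqY
  · by_contra hqp
    exact hq ⟨⟨hqb, hqY⟩, hqp⟩

/-- In a thin space an open set separating `A` and `B` can be shrunk to a finite union of small
balls that still separates. -/
theorem IsThin.exists_openSeparates_small (hthin : IsThin X) {A B U : Set X}
    (hA : IsConnected A) (hB : IsConnected B) (hU : OpenSeparates A B U) {r : ℝ} (hr : 0 < r) :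
    ∃ U', OpenSeparates A B U' ∧ closure U' ⊆ U ∧
      ∃ F : Set X, F.Finite ∧ closure U' ⊆ ⋃ x ∈ F, closedBall x r := by
  classical
  obtain ⟨a, ha⟩ := hA.nonempty
  obtain ⟨b, hb⟩ := hB.nonempty
  have hABU : A ∪ B ⊆ Uᶜ := by
    obtain ⟨-, P, Q, -, -, -, hun, hAP, hBQ⟩ := hU
    exact hun ▸ union_subset_union hAP hBQ
  have hne : (Uᶜ).Nonempty := ⟨a, hABU (Or.inl ha)⟩
  set N : Finset X → Set X := fun F => ⋃ x ∈ F, ball x (innerRadius U r x)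
  have hNo : ∀ F, IsOpen (N F) := fun F => isOpen_biUnion fun _ _ => isOpen_ball
  have hNc : ∀ F, closure (N F) = ⋃ x ∈ F, closure (ball x (innerRadius U r x)) :=
    fun F => F.finite_toSet.closure_biUnion _
  have hNU : ∀ F, closure (N F) ⊆ U := fun F => by
    rw [hNc]
    exact iUnion₂_subset fun x _ => closure_ball_innerRadius_subset U r x
  by_cases hex : ∃ F : Finset X, ∃ ε > 0, ¬ Relation.ReflTransGen (ChainStep (N F)ᶜ ε) a b
  · obtain ⟨F, ε, hε, hch⟩ := hex
    have hsub : Uᶜ ⊆ (N F)ᶜ := compl_subset_compl.2 (subset_closure.trans (hNU F))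
    refine ⟨N F, ?_, hNU F, F, F.finite_toSet, ?_⟩
    · rw [← compl_compl (N F)]
      exact openSeparates_of_not_chain (hNo F).isClosed_compl hA.isPreconnected hB.isPreconnected
        (subset_union_left.trans (hABU.trans hsub)) (subset_union_right.trans (hABU.trans hsub))
        ha hb hε hch
    · rw [hNc]
      exact iUnion₂_mono fun x _ => closure_ball_subset_closedBall.trans
        (closedBall_subset_closedBall (min_le_left _ _))
  · exfalso
    push Not at hex
    have hstep : ∀ (F : Finset X) (n : ℕ), ∃ C : Finset X, (C : Set X) ⊆ (N F)ᶜ ∧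
        Relation.ReflTransGen (ChainStep (C : Set X) (1 / (n + 1))) a b :=
      fun F n => exists_finset_chain (hex F _ Nat.one_div_pos_of_nat)
    choose f hf hfch using hstep
    let D : ℕ → Finset X := fun n => Nat.rec ∅ (fun n F => F ∪ f F n) n
    have hDs : ∀ n, D (n + 1) = D n ∪ f (D n) n := fun n => rfl
    have hDm : Monotone D := monotone_nat_of_le_succ fun n => by
      rw [hDs]; exact Finset.subset_union_left
    refine hthin.not_chains_of_isolated hU (Y := Uᶜ ∪ ⋃ n, (f (D n) n : Set X))
      subset_union_left (fun p hp => ?_) ha hb ?_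
    · refine exists_isOpen_inter_subset_singleton hU.1 hne hr (C := fun n => f (D n) n) ?_ hp
      intro m n hmn x hx y hy hyx
      have hxD : x ∈ D n := hDm (Nat.succ_le_of_lt hmn) (by
        change x ∈ D (m + 1)
        rw [hDs]; exact Finset.mem_union_right _ hx)
      exact hf (D n) n hy (mem_iUnion₂.2 ⟨x, hxD, hyx⟩)
    · intro ε hε
      obtain ⟨n, hn⟩ := exists_nat_one_div_lt hε
      exact Relation.ReflTransGen.mono (fun x y hxy => hxy.mono
        ((subset_iUnion (fun n => (f (D n) n : Set X)) n).trans subset_union_right) hn.le)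
        _ _ (hfch (D n) n)

/-- An ultrafilter in a complete space containing, for every `r > 0`, a finite union of balls of
radius `r` converges. -/
theorem Ultrafilter.exists_le_nhds_of_finite_cover [CompleteSpace X] (f : Ultrafilter X)
    (h : ∀ r > 0, ∃ F : Set X, F.Finite ∧ (⋃ x ∈ F, closedBall x r) ∈ f) :
    ∃ x, (f : Filter X) ≤ 𝓝 x := by
  refine CompleteSpace.complete (Metric.cauchy_iff.2 ⟨f.neBot, fun ε hε => ?_⟩)
  obtain ⟨F, hF, hmem⟩ := h (ε / 3) (by positivity)
  obtain ⟨x, -, hx⟩ := (Ultrafilter.finite_biUnion_mem_iff hF).1 hmem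
  refine ⟨_, hx, fun y hy z hz => ?_⟩
  rw [mem_closedBall] at hy hz
  have := dist_triangle_right y z x
  linarith

theorem OpenSeparates.separatesSets {A B U V : Set X} (hU : OpenSeparates A B U) (hUV : U ⊆ V)
    (hV : Disjoint V (A ∪ B)) : SeparatesSets V A B := by
  obtain ⟨-, P, Q, hP, hQ, hPQ, hun, hAP, hBQ⟩ := hU
  rw [disjoint_union_right] at hV
  refine ⟨P \ V, Q \ V, ?_, hPQ.mono sdiff_subset sdiff_subset, ⟨?_, ?_⟩,
    subset_sdiff.2 ⟨hAP, hV.1.symm⟩, subset_sdiff.2 ⟨hBQ, hV.2.symm⟩⟩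
  · rw [← union_sdiff_distrib, hun, Set.sdiff_eq, inter_eq_right]
    exact compl_subset_compl.2 hUV
  · exact (hPQ.mono (closure_minimal sdiff_subset hP) sdiff_subset).inter_eq
  · exact (hPQ.mono sdiff_subset (closure_minimal sdiff_subset hQ)).inter_eq

end Chains

/-- Every complete thin metric space has the compact separation property. -/
theorem stmt12 {X : Type*} [MetricSpace X] [CompleteSpace X] (hthin : IsThin X) :
    HasCSP X := by
  intro A B hAc hBc hA hB hAB
  have h0 : OpenSeparates A B (A ∪ B)ᶜ :=
    ⟨(hAc.union hBc).isOpen_compl, A, B, hAc, hBc, hAB, (compl_compl _).symm, subset_rfl,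
      subset_rfl⟩
  choose g hg hgU F hF hgF using fun (U : {U : Set X // OpenSeparates A B U}) (n : ℕ) =>
    hthin.exists_openSeparates_small hA hB U.2 (Nat.one_div_pos_of_nat (n := n) (α := ℝ))
  let S : ℕ → {U : Set X // OpenSeparates A B U} :=
    fun n => Nat.rec ⟨_, h0⟩ (fun n U => ⟨g U n, hg U n⟩) n
  have hSs : ∀ n, (S (n + 1)).1 = g (S n) n := fun n => rfl
  have hSc : ∀ n, closure (S (n + 1)).1 ⊆ (S n).1 := fun n => hgU (S n) n
  have hSm : Antitone fun n => (S n).1 :=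
    antitone_nat_of_succ_le fun n => subset_closure.trans (hSc n)
  have hlim : ∀ f : Ultrafilter X, (∀ n, (S n).1 ∈ f) → ∃ x, (f : Filter X) ≤ 𝓝 x := by
    intro f hf
    refine f.exists_le_nhds_of_finite_cover fun r hr => ?_
    obtain ⟨n, hn⟩ := exists_nat_one_div_lt hr
    refine ⟨F (S n) n, hF _ _, mem_of_superset (hf (n + 1)) ?_⟩
    exact subset_closure.trans ((hgF (S n) n).trans
      (iUnion₂_mono fun x _ => closedBall_subset_closedBall hn.le))
  have hlimK : ∀ (f : Ultrafilter X) (x : X), (∀ n, (S n).1 ∈ f) → (f : Filter X) ≤ 𝓝 x →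
      x ∈ ⋂ n, closure (S n).1 := fun f x hf hx =>
    mem_iInter.2 fun n => mem_closure_iff_ultrafilter.2 ⟨f, hf n, hx⟩
  have hKS : ∀ n, (⋂ n, closure (S n).1) ⊆ (S n).1 := fun n =>
    (iInter_subset _ (n + 1)).trans (hSc n)
  refine ⟨⋂ n, closure (S n).1, ?_, ?_, ?_⟩
  · rw [isCompact_iff_ultrafilter_le_nhds]
    intro f hf
    have hf' : ∀ n, (S n).1 ∈ f := fun n => mem_of_superset (le_principal_iff.1 hf) (hKS n)
    obtain ⟨x, hx⟩ := hlim f hf'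
    exact ⟨x, hlimK f x hf' hx, hx⟩
  · exact disjoint_left.2 fun x hx => hKS 0 hx
  · intro V hV hKV hVAB
    suffices h : ∃ n, (S n).1 ⊆ V by
      obtain ⟨n, hn⟩ := h
      exact (S n).2.separatesSets hn hVAB
    by_contra! hcon
    have hne : (⨅ n, 𝓟 ((S n).1 \ V)).NeBot := by
      refine iInf_neBot_of_directed' ?_ fun n => principal_neBot_iff.2 (sdiff_nonempty.2 (hcon n))
      exact (antitone_iff_forall_lt.2 fun m n hmn => principal_mono.2
        (sdiff_subset_sdiff_left (hSm hmn.le))).directed_ge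
    set f := Ultrafilter.of (⨅ n, 𝓟 ((S n).1 \ V))
    have hfm : ∀ n, (S n).1 \ V ∈ f := fun n =>
      Ultrafilter.of_le _ (mem_iInf_of_mem n (mem_principal_self _))
    have hf' : ∀ n, (S n).1 ∈ f := fun n => mem_of_superset (hfm n) sdiff_subset
    obtain ⟨x, hx⟩ := hlim f hf'
    have hxV : V ∈ f := hx (hV.mem_nhds (hKV (hlimK f x hf' hx)))
    obtain ⟨y, hyV, hy⟩ := f.neBot.nonempty_of_mem (inter_mem hxV (hfm 0))
    exact hy.2 hyV
end

section
/- Let (X, d) be a metric space in which all quasi-components are singletons (i.e., X is totally separated: any two distinct points can be separated by a partition of X into two clopen sets). Then X is straight if and only if X is UC. -/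
/-- A metric space is straight if for every cover by two closed sets, every continuous
real-valued function whose restrictions to both sets are uniformly continuous is
itself uniformly continuous. -/
def IsStraight (X : Type*) [MetricSpace X] : Prop :=
  ∀ F₁ F₂ : Set X, IsClosed F₁ → IsClosed F₂ → F₁ ∪ F₂ = Set.univ →
    ∀ f : X → ℝ, Continuous f → UniformContinuousOn f F₁ → UniformContinuousOn f F₂ →
      UniformContinuous f

open Set Filter Topology UniformSpace

/-- A property of pairs that holds eventually in the second variable holds for all pairs along a
suitable subsequence. -/
theorem exists_strictMono_forall_lt_of_eventually {r : ℕ → ℕ → Prop}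
    (h : ∀ m, ∀ᶠ n in atTop, r m n) :
    ∃ ψ : ℕ → ℕ, StrictMono ψ ∧ ∀ i j, i < j → r (ψ i) (ψ j) := by
  obtain ⟨ψ, -, hψ⟩ := exists_seq_of_forall_finset_exists (fun _ : ℕ => True)
    (fun m n => m < n ∧ r m n) fun s _ => by
      have : ∀ᶠ n in atTop, ∀ m ∈ s, m < n ∧ r m n :=
        (eventually_all_finset s).2 fun m _ => (eventually_gt_atTop m).and (h m)
      obtain ⟨n, hn⟩ := this.exists
      exact ⟨n, trivial, hn⟩
  exact ⟨ψ, fun i j hij => (hψ i j hij).1, fun i j hij => (hψ i j hij).2⟩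

/-- A set which is not totally bounded contains a uniformly discrete sequence. -/
theorem exists_separated_seq_of_not_totallyBounded {X : Type*} [PseudoMetricSpace X] {s : Set X}
    (hs : ¬ TotallyBounded s) :
    ∃ ε > 0, ∃ z : ℕ → X, (∀ n, z n ∈ s) ∧ Pairwise fun m n => ε ≤ dist (z m) (z n) := by
  rw [Metric.totallyBounded_iff] at hs
  push Not at hs
  obtain ⟨ε, hε, h⟩ := hs
  obtain ⟨z, hz, hzr⟩ := exists_seq_of_forall_finset_exists (· ∈ s)
    (fun x y => ε ≤ dist x y) fun t _ => by
      obtain ⟨y, hy, hyt⟩ := not_subset.1 (h t t.finite_toSet)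
      refine ⟨y, hy, fun x hx => ?_⟩
      by_contra! hlt
      exact hyt (mem_iUnion₂.2 ⟨x, hx, by rwa [Metric.mem_ball, dist_comm]⟩)
  refine ⟨ε, hε, z, hz, fun m n hmn => ?_⟩
  rcases hmn.lt_or_gt with hlt | hlt
  · exact hzr m n hlt
  · rw [dist_comm]
    exact hzr n m hlt

section

variable {X : Type*} [MetricSpace X]

/-- In a straight space, cutting a uniformly continuous function down to a relatively clopen part
of its positivity set preserves uniform continuity. -/
theorem IsStraight.uniformContinuous_indicator (hX : IsStraight X) {g : X → ℝ}
    (hg : UniformContinuous g) {C : Set X} (hC : IsOpen C) (hCg : C ⊆ {x | 0 < g x})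
    (hgC : IsOpen ({x | 0 < g x} \ C)) : UniformContinuous (C.indicator g) := by
  have hcl : EqOn (fun x => max (g x) 0) (C.indicator g) (closure C) := by
    intro x hx
    by_cases hxC : x ∈ C
    · simpa [hxC] using (hCg hxC).le
    · have hx0 : g x ≤ 0 := by
        by_contra! hpos
        obtain ⟨y, hy, hyC⟩ := mem_closure_iff.1 hx _ hgC ⟨hpos, hxC⟩
        exact hy.2 hyC
      simpa [hxC] using hx0
  have h₁ : UniformContinuousOn (C.indicator g) (closure C) :=
    ((LipschitzWith.id.max_const 0).uniformContinuous.comp hg).uniformContinuousOn.congr hcl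
  have h₂ : UniformContinuousOn (C.indicator g) Cᶜ :=
    (uniformContinuous_const (b := (0 : ℝ))).uniformContinuousOn.congr
      fun x hx => (indicator_of_notMem hx g).symm
  have huniv : closure C ∪ Cᶜ = univ :=
    eq_univ_of_forall fun x => (em (x ∈ C)).imp (subset_closure ·) id
  refine hX _ _ isClosed_closure hC.isClosed_compl huniv _ ?_ h₁ h₂
  rw [← continuousOn_univ, ← huniv]
  exact h₁.continuousOn.union_of_isClosed h₂.continuousOn isClosed_closure hC.isClosed_compl

/-- In a straight totally separated space, a uniformly discrete sequence cannot be approximated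
by a sequence of distinct companions. -/
theorem IsStraight.not_tendsto_dist_of_separated [TotallySeparatedSpace X] (hX : IsStraight X)
    {ε : ℝ} (hε : 0 < ε) {x y : ℕ → X} (hsep : Pairwise fun m n => ε ≤ dist (x m) (x n))
    (hne : ∀ n, x n ≠ y n) : ¬ Tendsto (fun n => dist (x n) (y n)) atTop (𝓝 0) := by
  intro hlim
  choose A hA hxA hyA using fun n => exists_isClopen_of_totally_separated (hne n)
  set r := ε / 2 with hr
  have hr0 : 0 < r := by positivity
  have hball : ∀ z m n, dist z (x m) < r → dist z (x n) < r → m = n := by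
    intro z m n hm hn
    by_contra hmn
    have := hsep hmn
    have := dist_triangle_left (x m) (x n) z
    linarith
  set g : X → ℝ := fun z => r - Metric.infDist z (range x) with hgdef
  have hg : UniformContinuous g :=
    uniformContinuous_const.sub (Metric.uniformContinuous_infDist_pt _)
  have hpos : ∀ z, 0 < g z ↔ ∃ n, dist z (x n) < r := by
    intro z
    simp [hgdef, Metric.infDist_lt_iff (range_nonempty x)]
  set C : Set X := ⋃ n, A n ∩ Metric.ball (x n) r
  have hCo : IsOpen C := isOpen_iUnion fun n => (hA n).isOpen.inter Metric.isOpen_ball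
  have hCg : C ⊆ {z | 0 < g z} := by
    intro z hz
    obtain ⟨n, -, hn⟩ := mem_iUnion.1 hz
    exact (hpos z).2 ⟨n, hn⟩
  have hmem : ∀ z n, dist z (x n) < r → (z ∈ C ↔ z ∈ A n) := by
    intro z n hn
    refine ⟨fun hz => ?_, fun hz => mem_iUnion.2 ⟨n, hz, hn⟩⟩
    obtain ⟨m, hm, hmr⟩ := mem_iUnion.1 hz
    rwa [← hball z m n hmr hn]
  have hdiff : {z | 0 < g z} \ C = ⋃ n, (A n)ᶜ ∩ Metric.ball (x n) r := by
    ext z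
    simp only [Set.mem_sdiff, mem_ofPred_eq, hpos, mem_iUnion, mem_inter_iff, mem_compl_iff,
      Metric.mem_ball]
    constructor
    · rintro ⟨⟨n, hn⟩, hz⟩
      exact ⟨n, fun h => hz ((hmem z n hn).2 h), hn⟩
    · rintro ⟨n, hz, hn⟩
      exact ⟨⟨n, hn⟩, fun h => hz ((hmem z n hn).1 h)⟩
  have huc := hX.uniformContinuous_indicator hg hCo hCg <| hdiff ▸
    isOpen_iUnion fun n => (hA n).compl.isOpen.inter Metric.isOpen_ball
  obtain ⟨δ, hδ, h⟩ := Metric.uniformContinuous_iff.1 huc r hr0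
  obtain ⟨n, hnδ, hnr⟩ :=
    ((hlim.eventually_lt_const hδ).and (hlim.eventually_lt_const hr0)).exists
  have hxC : x n ∈ C := (hmem _ n (by simpa using hr0)).2 (hxA n)
  have hyC : y n ∉ C := fun hy => hyA n ((hmem _ n (by rwa [dist_comm])).1 hy)
  have := h hnδ
  rw [indicator_of_mem hxC, indicator_of_notMem hyC] at this
  simp [hgdef, Metric.infDist_zero_of_mem (mem_range_self n), abs_of_pos hr0] at this

/-- In a straight totally separated space, a sequence approximated by distinct companions has
totally bounded range. -/
theorem IsStraight.totallyBounded_range [TotallySeparatedSpace X] (hX : IsStraight X)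
    {x y : ℕ → X} (hne : ∀ n, x n ≠ y n)
    (hlim : Tendsto (fun n => dist (x n) (y n)) atTop (𝓝 0)) : TotallyBounded (range x) := by
  by_contra htb
  obtain ⟨ε, hε, z, hz, hsep⟩ := exists_separated_seq_of_not_totallyBounded htb
  choose k hk using hz
  have hkinj : Function.Injective k := by
    intro m n hmn
    by_contra hne
    have := hsep hne
    simp only [← hk, hmn, dist_self] at this
    linarith
  simp only [← hk] at hsep
  exact hX.not_tendsto_dist_of_separated hε hsep (fun n => hne (k n))
    (hlim.comp hkinj.nat_tendsto_atTop)

theorem IsStraight.totallyBounded_setOf_not_isOpen_singleton [TotallySeparatedSpace X]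
    (hX : IsStraight X) : TotallyBounded {x : X | ¬ IsOpen {x}} := by
  by_contra htb
  obtain ⟨ε, hε, z, hz, hsep⟩ := exists_separated_seq_of_not_totallyBounded htb
  have hy : ∀ n : ℕ, ∃ y, z n ≠ y ∧ dist (z n) y < 1 / ((n : ℝ) + 1) := by
    intro n
    by_contra! h
    refine hz n (Metric.isOpen_singleton_iff.2 ⟨1 / ((n : ℝ) + 1), by positivity, fun y hy => ?_⟩)
    by_contra hne
    have := h y (Ne.symm hne)
    rw [dist_comm] at this
    linarith
  choose y hne hlt using hy
  exact hX.not_tendsto_dist_of_separated hε hsep hne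
    (squeeze_zero (fun _ => dist_nonneg) (fun n => (hlt n).le)
      tendsto_one_div_add_atTop_nhds_zero_nat)

/-- In a straight space, a relatively clopen subset of a punctured ball around a point of the
completion outside the space does not split the trace of the neighbourhoods of that point. -/
theorem IsStraight.eventually_mem_or_eventually_notMem (hX : IsStraight X) (p : Completion X)
    {r : ℝ} (hr : 0 < r) {C : Set X} (hC : IsOpen C)
    (hCr : C ⊆ {x : X | dist (x : Completion X) p < r})
    (hrC : IsOpen ({x : X | dist (x : Completion X) p < r} \ C)) :
    (∀ᶠ x in comap ((↑) : X → Completion X) (𝓝 p), x ∈ C) ∨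
      ∀ᶠ x in comap ((↑) : X → Completion X) (𝓝 p), x ∉ C := by
  by_contra! hsplit
  obtain ⟨hout, hin⟩ := hsplit
  set g : X → ℝ := fun x => r - dist (x : Completion X) p with hgdef
  have hg : UniformContinuous g :=
    uniformContinuous_const.sub
      ((Completion.uniformContinuous_coe X).dist uniformContinuous_const)
  have hset : {x : X | dist (x : Completion X) p < r} = {x | 0 < g x} := by simp [hgdef]
  rw [hset] at hCr hrC
  obtain ⟨δ, hδ, h⟩ :=
    Metric.uniformContinuous_iff.1 (hX.uniformContinuous_indicator hg hC hCr hrC) (r / 2)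
      (half_pos hr)
  have hnear : ∀ {η : ℝ}, 0 < η →
      ∀ᶠ x : X in comap ((↑) : X → Completion X) (𝓝 p), dist (x : Completion X) p < η :=
    fun hη => preimage_mem_comap (Metric.ball_mem_nhds p hη)
  have hF := (hnear (half_pos hδ)).and (hnear (half_pos hr))
  obtain ⟨x, hxC, hxδ, hxr⟩ := (hin.and_eventually hF).exists
  obtain ⟨y, hyC, hyδ, -⟩ := (hout.and_eventually hF).exists
  have hxy : dist x y < δ := by
    rw [← Completion.dist_eq]
    have := dist_triangle_right (x : Completion X) y p
    linarith
  have := h hxy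
  rw [indicator_of_mem hxC, indicator_of_notMem hyC, Real.dist_0_eq_abs, abs_lt] at this
  simp only [hgdef] at this
  linarith

/-- A straight space admits no partition of a punctured ball around a point of the completion
outside the space into relatively clopen pieces staying away from that point. -/
theorem IsStraight.not_forall_eventually_ne (hX : IsStraight X) (p : Completion X) {r : ℝ}
    (hr : 0 < r) {T : Type*} (l : X → T)
    (hl : ∀ x : X, dist (x : Completion X) p < r → ∀ᶠ y in 𝓝 x, l y = l x) :
    ¬ ∀ x : X, dist (x : Completion X) p < r →
      ∀ᶠ y in comap ((↑) : X → Completion X) (𝓝 p), l y ≠ l x := by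
  intro haway
  have : (comap ((↑) : X → Completion X) (𝓝 p)).NeBot :=
    (Completion.isDenseInducing_coe).comap_nhds_neBot p
  obtain ⟨u, hu⟩ := exists_seq_tendsto (comap ((↑) : X → Completion X) (𝓝 p))
  set U : Set X := {x | dist (x : Completion X) p < r}
  have hUo : IsOpen U := isOpen_lt ((Completion.continuous_coe X).dist continuous_const)
    continuous_const
  have hUF : U ∈ comap ((↑) : X → Completion X) (𝓝 p) :=
    preimage_mem_comap (Metric.ball_mem_nhds p hr)
  obtain ⟨ψ, hψ, hψr⟩ := exists_strictMono_forall_lt_of_eventually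
    (r := fun m n => u m ∈ U → l (u n) ≠ l (u m)) fun m => by
      by_cases hm : u m ∈ U
      · exact (hu.eventually (haway _ hm)).mono fun n hn _ => hn
      · exact Eventually.of_forall fun n h => absurd h hm
  have hz : Tendsto (u ∘ ψ) atTop (comap ((↑) : X → Completion X) (𝓝 p)) :=
    hu.comp hψ.tendsto_atTop
  obtain ⟨N, hN⟩ := eventually_atTop.1 (hz.eventually hUF)
  set I : Set T := {t | ∃ k, N ≤ 2 * k ∧ l (u (ψ (2 * k))) = t}
  have hopen : ∀ J : Set T, IsOpen (U ∩ l ⁻¹' J) := by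
    intro J
    rw [isOpen_iff_eventually]
    rintro x ⟨hxU, hxJ⟩
    filter_upwards [hUo.mem_nhds hxU, hl x hxU] with y hyU hy
    exact ⟨hyU, by simpa [hy] using hxJ⟩
  have hdiff : U \ (U ∩ l ⁻¹' I) = U ∩ l ⁻¹' Iᶜ := by
    ext x
    simp +contextual
  rcases hX.eventually_mem_or_eventually_notMem p hr (hopen I) inter_subset_left
    (hdiff ▸ hopen Iᶜ) with h | h
  · obtain ⟨M, hM⟩ := eventually_atTop.1 (hz.eventually h)
    obtain ⟨-, k, hk, hlk⟩ := hM (2 * (M + N) + 1) (by omega)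
    rcases lt_or_gt_of_ne (show 2 * k ≠ 2 * (M + N) + 1 by omega) with hlt | hlt
    · exact hψr _ _ hlt (hN _ hk) hlk.symm
    · exact hψr _ _ hlt (hN _ (by omega)) hlk
  · obtain ⟨M, hM⟩ := eventually_atTop.1 (hz.eventually h)
    exact hM (2 * (M + N)) (by omega) ⟨hN _ (by omega), M + N, by omega, rfl⟩

theorem IsStraight.completeSpace [TotallySeparatedSpace X] (hX : IsStraight X) :
    CompleteSpace X := by
  by_contra hcomplete
  have hsurj : ¬ Function.Surjective ((↑) : X → Completion X) := fun hs =>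
    hcomplete (((Completion.isUniformInducing_coe X).completeSpace_congr hs).2 inferInstance)
  obtain ⟨p, hp⟩ := not_forall.1 hsurj
  have hxp : ∀ x : X, 0 < dist (x : Completion X) p := fun x => dist_pos.2 fun h => hp ⟨x, h⟩
  set F := comap ((↑) : X → Completion X) (𝓝 p)
  have : F.NeBot := (Completion.isDenseInducing_coe).comap_nhds_neBot p
  have hneF : ∀ x : X, ∀ᶠ y in F, y ≠ x := by
    intro x
    filter_upwards [preimage_mem_comap (Metric.ball_mem_nhds p (hxp x))] with y hy hyx
    simp [hyx] at hy
  have hclopen : ∀ A : Set X, IsClopen A → (∀ᶠ x in F, x ∈ A) ∨ ∀ᶠ x in F, x ∉ A := by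
    intro A hA
    set U : Set X := {x | dist (x : Completion X) p < 1}
    have hUo : IsOpen U := isOpen_lt ((Completion.continuous_coe X).dist continuous_const)
      continuous_const
    have hUF : U ∈ F := preimage_mem_comap (Metric.ball_mem_nhds p one_pos)
    have hdiff : U \ (U ∩ A) = U ∩ Aᶜ := by
      ext x
      simp +contextual
    refine (hX.eventually_mem_or_eventually_notMem p one_pos (hUo.inter hA.isOpen)
      inter_subset_left (hdiff ▸ hUo.inter hA.compl.isOpen)).imp
        (fun h => h.mono fun x hx => hx.2) fun h => ?_
    filter_upwards [h, hUF] with x hx hxU hxA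
    exact hx ⟨hxU, hxA⟩
  have hexc : ∃ r > 0, ∀ x : X, dist (x : Completion X) p < r →
      ∃ A : Set X, IsClopen A ∧ x ∈ A ∧ ∀ᶠ y in F, y ∉ A := by
    by_cases h : ∀ x : X, ∃ A : Set X, IsClopen A ∧ x ∈ A ∧ ∀ᶠ y in F, y ∉ A
    · exact ⟨1, one_pos, fun x _ => h x⟩
    · obtain ⟨q, hq⟩ := not_forall.1 h
      refine ⟨dist (q : Completion X) p, hxp q, fun x hx => ?_⟩
      have hqx : x ≠ q := by
        rintro rfl
        exact hx.false
      obtain ⟨A, hA, hxA, hqA⟩ := exists_isClopen_of_totally_separated hqx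
      rcases hclopen A hA with h | h
      · exact absurd ⟨Aᶜ, hA.compl, hqA, h.mono fun y hy => not_not.2 hy⟩ hq
      · exact ⟨A, hA, hxA, h⟩
  obtain ⟨r, hr, hcover⟩ := hexc
  have hcover' : ∀ x : X, ∃ A : Set X, IsClopen A ∧
      (dist (x : Completion X) p < r → x ∈ A) ∧ ∀ᶠ y in F, y ∉ A := by
    intro x
    by_cases hx : dist (x : Completion X) p < r
    · obtain ⟨A, hA, hxA, hAF⟩ := hcover x hx
      exact ⟨A, hA, fun _ => hxA, hAF⟩
    · exact ⟨∅, isClopen_empty, fun h => absurd h hx, by simp⟩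
  choose A hA hxA hAF using hcover'
  set M : Set X := {x | ¬ IsOpen {x}} ∩ {x | dist (x : Completion X) p < r}
  have hMlin : IsLindelof M := by
    have := (hX.totallyBounded_setOf_not_isOpen_singleton.isSeparable.mono
      (inter_subset_left : M ⊆ _)).secondCountableTopology
    exact isLindelof_iff_lindelofSpace.2 inferInstance
  obtain ⟨t, htc, -, htM⟩ := hMlin.elim_nhds_subcover A
    fun x hx => (hA x).isOpen.mem_nhds (hxA x hx.2)
  obtain ⟨x₀⟩ := F.nonempty_of_neBot
  obtain ⟨a, ha⟩ := (htc.insert x₀).exists_eq_range (insert_nonempty x₀ t)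
  classical
  set l : X → ℕ ⊕ X := fun x =>
    if h : ∃ n, x ∈ A (a n) then Sum.inl (Nat.find h) else Sum.inr x with hl
  have hl_inl : ∀ x n, l x = Sum.inl n ↔ x ∈ A (a n) ∧ ∀ k < n, x ∉ A (a k) := by
    intro x n
    by_cases h : ∃ n, x ∈ A (a n)
    · simp only [hl, dif_pos h, Sum.inl.injEq, Nat.find_eq_iff]
    · simp only [hl, dif_neg h, reduceCtorEq, false_iff]
      exact fun hn => h ⟨n, hn.1⟩
  have hl_inr : ∀ x y, l x = Sum.inr y → x = y := by
    intro x y hxy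
    by_cases h : ∃ n, x ∈ A (a n)
    · simp [hl, dif_pos h] at hxy
    · simpa [hl, dif_neg h] using hxy
  refine hX.not_forall_eventually_ne p hr l (fun x hx => ?_) (fun x _ => ?_)
  · rcases hlx : l x with n | y
    · have hn := (hl_inl x n).1 hlx
      have hk : ∀ᶠ y in 𝓝 x, ∀ k ∈ Finset.range n, y ∉ A (a k) :=
        (eventually_all_finset _).2 fun k hk =>
          (hA (a k)).compl.isOpen.mem_nhds (hn.2 k (Finset.mem_range.1 hk))
      filter_upwards [(hA (a n)).isOpen.mem_nhds hn.1, hk] with y hy hyk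
      exact (hl_inl y n).2 ⟨hy, fun k hk => hyk k (Finset.mem_range.2 hk)⟩
    · have hiso : IsOpen {x} := by
        by_contra hx'
        obtain ⟨b, hbt, hb⟩ := mem_iUnion₂.1 (htM ⟨hx', hx⟩)
        obtain ⟨n, rfl⟩ : b ∈ range a := ha ▸ mem_insert_of_mem _ hbt
        have h : ∃ n, x ∈ A (a n) := ⟨n, hb⟩
        simp [hl, dif_pos h] at hlx
      filter_upwards [hiso.mem_nhds rfl] with z hz
      rw [mem_singleton_iff.1 hz, hlx]
  · rcases hlx : l x with n | y
    · exact (hAF (a n)).mono fun y hy h => hy ((hl_inl y n).1 h).1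
    · exact (hneF y).mono fun z hz h => hz (hl_inr z y h)

end

/-- A totally separated metric space (all quasi-components are singletons) is straight
iff it is UC, i.e. every continuous real-valued function on it is uniformly
continuous. -/
theorem stmt18 {X : Type*} [MetricSpace X] [TotallySeparatedSpace X] :
    IsStraight X ↔ ∀ f : X → ℝ, Continuous f → UniformContinuous f := by
  refine ⟨fun hX f hf => ?_, fun h _ _ _ _ _ f hf _ _ => h f hf⟩
  by_contra huc
  rw [Metric.uniformContinuous_iff] at huc
  push Not at huc
  obtain ⟨ε, hε, h⟩ := huc
  choose x y hxy hfxy using fun n : ℕ => h (1 / ((n : ℝ) + 1)) (by positivity)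
  have hne : ∀ n, x n ≠ y n := by
    intro n hn
    have := hfxy n
    rw [hn, dist_self] at this
    linarith
  have hlim : Tendsto (fun n => dist (x n) (y n)) atTop (𝓝 0) :=
    squeeze_zero (fun _ => dist_nonneg) (fun n => (hxy n).le)
      tendsto_one_div_add_atTop_nhds_zero_nat
  have := hX.completeSpace
  have hK : IsCompact (closure (range x)) :=
    (hX.totallyBounded_range hne hlim).closure.isCompact_of_isClosed isClosed_closure
  obtain ⟨a, -, φ, hφ, hxa⟩ := hK.tendsto_subseq fun n => subset_closure (mem_range_self n)
  have hya : Tendsto (y ∘ φ) atTop (𝓝 a) :=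
    hxa.congr_dist (hlim.comp hφ.tendsto_atTop)
  have hdist := ((hf.tendsto a).comp hxa).dist ((hf.tendsto a).comp hya)
  rw [dist_self] at hdist
  obtain ⟨n, hn⟩ := (hdist.eventually_lt_const hε).exists
  exact (hfxy (φ n)).not_gt hn
end
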